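/- arXiv:2301.08240 — 8 statements merged into one kernel-verified Lean document; each statement's English description precedes it below -/
import Mathlib

section
/- Let M denote the monoid, under composition, of injective self-maps of ℕ, and let H be a finite group. Then there exists an injective monoid homomorphism i : H → M such that ℕ, equipped with the action h · n = i(h)(n), is a complete H-set universe. Moreover, if i, j : H → M are two injective homomorphisms with universal image, then there exists an invertible element φ of M (i.e. a bijection ℕ → ℕ) such that i(h) = φ ∘ j(h) ∘ φ⁻¹ for all h ∈ H. -/
/-!
Statement 1: Let `M` be the monoid (under composition) of injective self-maps of `ℕ` and let
`H` be a finite group.  Then there is an injective monoid homomorphism `i : H → M` whose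
tautological action makes `ℕ` a complete `H`-set universe, and any two such homomorphisms are
conjugate by an invertible element of `M` (i.e. a bijection `ℕ ≃ ℕ`).
-/

/-- The monoid of injective self-maps of `ℕ`, under composition. -/
def InjMonoid : Type := {f : ℕ → ℕ // Function.Injective f}

instance : Monoid InjMonoid where
  one := ⟨id, Function.injective_id⟩
  mul f g := ⟨f.1 ∘ g.1, f.2.comp g.2⟩
  mul_assoc _ _ _ := rfl
  one_mul _ := rfl
  mul_one _ := rfl

/-- `i : H →* M` has universal image: `ℕ`, equipped with the tautological `H`-action through
`i`, is a complete `H`-set universe, i.e. every countable `H`-set admits an injective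
`H`-equivariant map into it. -/
def HasUniversalImage {H : Type} [Group H] (i : H →* InjMonoid) : Prop :=
  ∀ (X : Type) [MulAction H X] [Countable X],
    ∃ f : X → ℕ, Function.Injective f ∧ ∀ (h : H) (x : X), f (h • x) = (i h).1 (f x)

inductive SBSet {A B : Type} (F : A → B) (G : B → A) : A → Prop
  | base (x : A) (hx : ∀ b, G b ≠ x) : SBSet F G x
  | step (x : A) (hx : SBSet F G x) : SBSet F G (G (F x))

theorem SBSet.inv {A B : Type} {F : A → B} {G : B → A} (x : A) (hx : SBSet F G x) :
    (∀ b, G b ≠ x) ∨ ∃ y, SBSet F G y ∧ x = G (F y) := by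
  cases hx with
  | base _ h => exact Or.inl h
  | step y h => exact Or.inr ⟨y, h, rfl⟩

theorem equivariant_sb {H A B : Type} [Group H] [MulAction H A] [MulAction H B]
    (F : A → B) (G : B → A) (hF : Function.Injective F) (hG : Function.Injective G)
    (eF : ∀ (h : H) x, F (h • x) = h • F x) (eG : ∀ (h : H) x, G (h • x) = h • G x) :
    ∃ φ : A ≃ B, ∀ (h : H) x, φ (h • x) = h • φ x := by
  classical
  have hs : ∀ (h : H) x, SBSet F G x → SBSet F G (h • x) := by
    intro h x hx
    induction hx with
    | base x hx =>
      refine SBSet.base _ fun b hb => hx (h⁻¹ • b) ?_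
      rw [eG, hb, inv_smul_smul]
    | step x _ ih =>
      rw [← eG, ← eF]
      exact SBSet.step _ ih
  have hs' : ∀ (h : H) x, SBSet F G (h • x) → SBSet F G x := by
    intro h x hx
    simpa using hs h⁻¹ _ hx
  have key : ∀ x, ∃ b, (SBSet F G x ∧ b = F x) ∨ (¬ SBSet F G x ∧ G b = x) := by
    intro x
    by_cases hx : SBSet F G x
    · exact ⟨F x, Or.inl ⟨hx, rfl⟩⟩
    · by_contra hc
      push Not at hc
      exact hx (SBSet.base x fun b => (hc b).2 hx)
  choose φ hφ using key
  have hinj : Function.Injective φ := by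
    intro x y hxy
    rcases hφ x with ⟨hx, ex⟩ | ⟨hx, ex⟩ <;> rcases hφ y with ⟨hy, ey⟩ | ⟨hy, ey⟩
    · exact hF (by rw [← ex, ← ey, hxy])
    · exact absurd (by rw [← ey, ← hxy, ex]; exact SBSet.step _ hx) hy
    · exact absurd (by rw [← ex, hxy, ey]; exact SBSet.step _ hy) hx
    · rw [← ex, ← ey, hxy]
  have hsurj : Function.Surjective φ := by
    intro b
    by_cases hb : SBSet F G (G b)
    · rcases SBSet.inv _ hb with h | ⟨y, hy, e⟩
      · exact absurd rfl (h b)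
      · refine ⟨y, ?_⟩
        rcases hφ y with ⟨_, ey⟩ | ⟨hn, _⟩
        · rw [ey, hG e]
        · exact absurd hy hn
    · refine ⟨G b, ?_⟩
      rcases hφ (G b) with ⟨hn, _⟩ | ⟨_, e⟩
      · exact absurd hn hb
      · exact hG e
  refine ⟨Equiv.ofBijective φ ⟨hinj, hsurj⟩, fun h x => ?_⟩
  change φ (h • x) = h • φ x
  rcases hφ x with ⟨hx, ex⟩ | ⟨hx, ex⟩ <;> rcases hφ (h • x) with ⟨hy, ey⟩ | ⟨hy, ey⟩
  · rw [ey, ex, eF]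
  · exact absurd (hs h x hx) hy
  · exact absurd (hs' h x hy) hx
  · exact hG (by rw [ey, eG, ex])

/-- The tautological action. -/
def tautAction {H : Type} [Group H] (i : H →* InjMonoid) : MulAction H ℕ where
  smul h n := (i h).1 n
  one_smul n := by
    change (i 1).1 n = n
    rw [map_one]; rfl
  mul_smul a b n := by
    change (i (a * b)).1 n = (i a).1 ((i b).1 n)
    rw [map_mul]; rfl

theorem exists_universal (H : Type) [Group H] [Finite H] :
    ∃ i : H →* InjMonoid, Function.Injective i ∧ HasUniversalImage i := by
  obtain ⟨e⟩ : Nonempty ((H → ℕ) ≃ ℕ) := nonempty_equiv_of_countable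
  let i : H →* InjMonoid :=
    { toFun := fun h => ⟨fun n => e (fun g => e.symm n (g * h)), by
        intro m n hmn
        apply e.symm.injective
        funext g
        have := congrFun (e.injective hmn) (g * h⁻¹)
        simpa using this⟩
      map_one' := by
        apply Subtype.ext
        funext n
        change e (fun g => e.symm n (g * 1)) = n
        simp
      map_mul' := by
        intro a b
        apply Subtype.ext
        funext n
        change e (fun g => e.symm n (g * (a * b))) =
          e (fun g => e.symm (e (fun g => e.symm n (g * b))) (g * a))
        simp [mul_assoc] }
  have hu : HasUniversalImage i := by
    intro X _ _
    obtain ⟨c, hc⟩ := exists_injective_nat X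
    refine ⟨fun x => e (fun g => c (g • x)), ?_, ?_⟩
    · intro x y hxy
      have := congrFun (e.injective hxy) 1
      exact hc (by simpa using this)
    · intro h x
      change e (fun g => c (g • h • x)) =
        e (fun g => e.symm (e (fun g => c (g • x))) (g * h))
      simp [mul_smul]
  refine ⟨i, ?_, hu⟩
  intro a b hab
  obtain ⟨f, hf, hfe⟩ := hu H
  have h1 := hfe a 1
  rw [hab, ← hfe b 1] at h1
  simpa using hf h1

theorem exists_universal_embedding_and_conjugacy (H : Type) [Group H] [Finite H] :
    (∃ i : H →* InjMonoid, Function.Injective i ∧ HasUniversalImage i) ∧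
    (∀ i j : H →* InjMonoid, Function.Injective i → Function.Injective j →
      HasUniversalImage i → HasUniversalImage j →
      ∃ φ : ℕ ≃ ℕ, ∀ h : H, (i h).1 = ⇑φ ∘ (j h).1 ∘ ⇑φ.symm) := by
  refine ⟨exists_universal H, ?_⟩
  intro i j _ _ hi hj
  obtain ⟨F, hF, eF⟩ := @hi ℕ (tautAction j) _
  obtain ⟨G, hG, eG⟩ := @hj ℕ (tautAction i) _
  obtain ⟨φ, hφ⟩ := @equivariant_sb H ℕ ℕ _ (tautAction j) (tautAction i) F G hF hG eF eG
  refine ⟨φ, fun h => ?_⟩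
  funext n
  have := hφ h (φ.symm n)
  rw [φ.apply_symm_apply] at this
  exact this.symm
end

section
/- Let T be a category and f : X ⟶ Y a morphism of presheaves of sets on T. Then f is a disjoint summand inclusion if and only if for every object A of T and every morphism t : y(A) ⟶ Y the base change t*f : y(A) ×_Y X ⟶ y(A) is a disjoint summand inclusion; equivalently, if and only if for every such t either t*f is an isomorphism or the presheaf y(A) ×_Y X is initial (empty). -/
open CategoryTheory CategoryTheory.Limits

universe u

variable (T : Type u) [SmallCategory T]

/-- The category of presheaves of sets on `T`. -/
abbrev PSh := Tᵒᵖ ⥤ Type u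

variable {T}

/-- A morphism of presheaves is a disjoint summand inclusion if together with some
`g : Z ⟶ Y` it exhibits `Y` as a coproduct of `X` and `Z`. -/
def IsDisjointSummandInclusion {X Y : PSh T} (f : X ⟶ Y) : Prop :=
  ∃ (Z : PSh T) (g : Z ⟶ Y), Nonempty (IsColimit (BinaryCofan.mk f g))

/-- A presheaf is a finite `T`-set if it is isomorphic to a finite coproduct of
representables. -/
def IsFiniteTSet (X : PSh T) : Prop :=
  ∃ (n : ℕ) (A : Fin n → T), Nonempty (X ≅ ∐ fun i => yoneda.obj (A i))

/-- A morphism of presheaves lies in `𝔽^P` if it is isomorphic to a finite disjoint union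
of morphisms of the form `(pᵢ)ᵢ : ⨿ᵢ y(Aᵢ) ⟶ y(B)` induced by morphisms `pᵢ : Aᵢ → B`
of `P`. -/
def MemFinP (P : MorphismProperty T) {X Y : PSh T} (f : X ⟶ Y) : Prop :=
  ∃ (n m : ℕ) (A : Fin n → T) (B : Fin m → T) (σ : Fin n → Fin m)
    (p : ∀ i, A i ⟶ B (σ i)), (∀ i, P (p i)) ∧
    ∃ (eX : X ≅ ∐ fun i => yoneda.obj (A i)) (eY : Y ≅ ∐ fun j => yoneda.obj (B j)),
      f ≫ eY.hom =
        eX.hom ≫ Sigma.desc fun i =>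
          yoneda.map (p i) ≫ Sigma.ι (fun j => yoneda.obj (B j)) (σ i)

/-- `P` is a wide subcategory: it contains all isomorphisms and is closed under
composition. -/
def IsWideSubcategory (P : MorphismProperty T) : Prop :=
  (∀ {A B : T} (f : A ⟶ B), IsIso f → P f) ∧
  (∀ {A B C : T} (f : A ⟶ B) (g : B ⟶ C), P f → P g → P (f ≫ g))

/-- `P` is orbital: base changes of morphisms in `𝔽^P` along morphisms of finite `T`-sets
again lie in `𝔽^P`. -/
def IsOrbital (P : MorphismProperty T) : Prop :=
  ∀ {X Y Z : PSh T} (f : X ⟶ Z) (g : Y ⟶ Z), MemFinP P f → IsFiniteTSet Y →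
    MemFinP P (pullback.snd f g)

/-- `P` is atomic orbital: it is orbital and the diagonal of `y(p)` is a disjoint summand
inclusion for every `p` in `P`. -/
def IsAtomicOrbital (P : MorphismProperty T) : Prop :=
  IsOrbital P ∧
    ∀ {A B : T} (p : A ⟶ B), P p → IsDisjointSummandInclusion (pullback.diagonal (yoneda.map p))

/-!
Statement 5: a morphism `f : X ⟶ Y` of presheaves of sets on `T` is a disjoint summand
inclusion iff all of its base changes to representables are disjoint summand inclusions,
iff each such base change is an isomorphism or has empty (initial) source.
-/

open Opposite in
theorem aux_char {T : Type u} [SmallCategory T] {X Y : PSh T} (f : X ⟶ Y) :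
    IsDisjointSummandInclusion f ↔
      (∀ U, Function.Injective (f.app U)) ∧
      (∀ (U V : Tᵒᵖ) (h : U ⟶ V) (y : Y.obj U),
        (∃ x, f.app V x = Y.map h y) → ∃ x, f.app U x = y) := by
  constructor
  · rintro ⟨Z, g, ⟨hc⟩⟩
    have key : ∀ U : Tᵒᵖ, Function.Injective (f.app U) ∧ Function.Injective (g.app U) ∧
        IsCompl (Set.range (f.app U)) (Set.range (g.app U)) := fun U =>
      (Types.binaryCofan_isColimit_iff _).1
        ⟨mapIsColimitOfPreservesOfIsColimit ((evaluation Tᵒᵖ (Type u)).obj U) f g hc⟩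
    refine ⟨fun U => (key U).1, ?_⟩
    rintro U V h y ⟨x, hx⟩
    have h1 : y ∈ Set.range (f.app U) ∪ Set.range (g.app U) := by
      have := (key U).2.2.sup_eq_top
      change _ ∪ _ = Set.univ at this
      rw [this]; trivial
    rcases h1 with h1 | ⟨z, rfl⟩
    · exact h1
    · exfalso
      have hz : g.app V (Z.map h z) = Y.map h (g.app U z) := NatTrans.naturality_apply g h z
      exact Set.disjoint_left.1 (key V).2.2.disjoint ⟨x, hx⟩ ⟨_, hz⟩
  · rintro ⟨hi, hr⟩
    let S : Subfunctor Y :=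
      { obj := fun U => (Set.range (f.app U))ᶜ
        map := fun {U V} i y hy hy' => hy (hr U V i y hy') }
    refine ⟨S.toFunctor, S.ι, ⟨evaluationJointlyReflectsColimits _ fun U => ?_⟩⟩
    refine (isColimitMapCoconeBinaryCofanEquiv ((evaluation Tᵒᵖ (Type u)).obj U) f S.ι).symm ?_
    refine Nonempty.some ((Types.binaryCofan_isColimit_iff _).2 ⟨hi U, ?_, ?_⟩)
    · exact fun a b hab => Subtype.ext hab
    · have : Set.range (S.ι.app U) = (Set.range (f.app U))ᶜ := by
        ext y
        exact ⟨by rintro ⟨z, rfl⟩; exact z.2, fun hy => ⟨⟨y, hy⟩, rfl⟩⟩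
      change IsCompl (Set.range (f.app U)) (Set.range (S.ι.app U))
      rw [this]
      exact isCompl_compl

theorem aux_pb {T : Type u} [SmallCategory T] {X Y W : PSh T} (f : X ⟶ Y) (t : W ⟶ Y)
    (U : Tᵒᵖ) (x : X.obj U) (w : W.obj U) (h : f.app U x = t.app U w) :
    ∃ p : (pullback f t).obj U, (pullback.fst f t).app U p = x ∧
      (pullback.snd f t).app U p = w :=
  Types.exists_of_isPullback
    ((IsPullback.of_hasPullback f t).map ((evaluation Tᵒᵖ (Type u)).obj U)) x w h

theorem aux_pb_ext {T : Type u} [SmallCategory T] {X Y W : PSh T} (f : X ⟶ Y) (t : W ⟶ Y)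
    (U : Tᵒᵖ) (p q : (pullback f t).obj U)
    (h : (pullback.fst f t).app U p = (pullback.fst f t).app U q)
    (h' : (pullback.snd f t).app U p = (pullback.snd f t).app U q) : p = q :=
  Types.ext_of_isPullback
    ((IsPullback.of_hasPullback f t).map ((evaluation Tᵒᵖ (Type u)).obj U)) h h'

theorem aux_pb_w {T : Type u} [SmallCategory T] {X Y W : PSh T} (f : X ⟶ Y) (t : W ⟶ Y)
    (U : Tᵒᵖ) (p : (pullback f t).obj U) :
    f.app U ((pullback.fst f t).app U p) = t.app U ((pullback.snd f t).app U p) :=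
  ConcreteCategory.congr_hom
    ((IsPullback.of_hasPullback f t).map ((evaluation Tᵒᵖ (Type u)).obj U)).w p

theorem aux_initial {T : Type u} [SmallCategory T] (P : PSh T) :
    Nonempty (IsInitial P) ↔ ∀ U, IsEmpty (P.obj U) := by
  constructor
  · rintro ⟨h⟩ U
    exact ⟨fun p => PEmpty.elim ((h.to ((Functor.const _).obj PEmpty.{u+1})).app U p)⟩
  · intro h
    refine ⟨IsInitial.ofUniqueHom
      (fun Q => { app := fun U => ↾fun p => ((h U).false p).elim
                  naturality := fun U V i => by ext p; exact ((h U).false p).elim }) ?_⟩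
    intro Q m
    ext U p
    exact ((h U).false p).elim

theorem aux_base {T : Type u} [SmallCategory T] {X Y W : PSh T} (f : X ⟶ Y) (t : W ⟶ Y)
    (hf : IsDisjointSummandInclusion f) : IsDisjointSummandInclusion (pullback.snd f t) := by
  rw [aux_char] at hf ⊢
  obtain ⟨hi, hr⟩ := hf
  refine ⟨fun U p q h => aux_pb_ext f t U p q (hi U ?_) h, ?_⟩
  · rw [aux_pb_w, aux_pb_w, h]
  · rintro U V h w ⟨p, hp⟩
    obtain ⟨x, hx⟩ := hr U V h (t.app U w) ⟨(pullback.fst f t).app V p, by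
      rw [aux_pb_w, hp]; exact NatTrans.naturality_apply t h w⟩
    obtain ⟨q, -, hq⟩ := aux_pb f t U x w hx
    exact ⟨q, hq⟩

theorem aux_rep {T : Type u} [SmallCategory T] {A : T} {P : PSh T} (s : P ⟶ yoneda.obj A)
    (hs : IsDisjointSummandInclusion s) : IsIso s ∨ Nonempty (IsInitial P) := by
  rw [aux_char] at hs
  obtain ⟨hi, hr⟩ := hs
  by_cases h : ∃ p, s.app (Opposite.op A) p = 𝟙 A
  · left
    obtain ⟨p, hp⟩ := h
    have : ∀ U, IsIso (s.app U) := fun U => by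
      rw [isIso_iff_bijective]
      refine ⟨hi U, fun a => ⟨P.map (Quiver.Hom.op (show U.unop ⟶ A from a)) p, ?_⟩⟩
      refine (NatTrans.naturality_apply s _ p).trans ?_
      rw [hp]
      exact Category.comp_id (show U.unop ⟶ A from a)
    exact NatIso.isIso_of_isIso_app s
  · right
    rw [aux_initial]
    refine fun U => ⟨fun p => h (hr _ U (Quiver.Hom.op (show U.unop ⟶ A from s.app U p)) (𝟙 A)
      ⟨p, ?_⟩)⟩
    exact (Category.comp_id (show U.unop ⟶ A from s.app U p)).symm

theorem aux_back {T : Type u} [SmallCategory T] {X Y : PSh T} (f : X ⟶ Y)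
    (H : ∀ (A : T) (t : yoneda.obj A ⟶ Y),
        IsIso (pullback.snd f t) ∨ Nonempty (IsInitial (pullback f t))) :
    IsDisjointSummandInclusion f := by
  have key : ∀ (A : T) (t : yoneda.obj A ⟶ Y) (U : Tᵒᵖ) (_ : (pullback f t).obj U) (V : Tᵒᵖ),
      Function.Bijective ((pullback.snd f t).app V) := by
    intro A t U p V
    rcases H A t with h | h
    · rw [← isIso_iff_bijective]; infer_instance
    · rw [aux_initial] at h
      exact ((h U).false p).elim
  have hy : ∀ (U V : Tᵒᵖ) (h : U ⟶ V) (y : Y.obj U),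
      (yonedaEquiv.symm (show Y.obj (Opposite.op U.unop) from y)).app V h.unop = Y.map h y :=
    fun U V h y => yonedaEquiv_symm_app_apply (X := U.unop) y V h.unop
  have hy1 : ∀ (U : Tᵒᵖ) (y : Y.obj U),
      (yonedaEquiv.symm (show Y.obj (Opposite.op U.unop) from y)).app U (𝟙 U.unop) = y :=
    fun U y => (hy U U (𝟙 U) y).trans (by simp)
  rw [aux_char]
  constructor
  · intro U x x' h
    obtain ⟨p, hp, hp'⟩ := aux_pb f _ U x _ (hy1 U (f.app U x)).symm
    obtain ⟨q, hq, hq'⟩ := aux_pb f _ U x' _ (h.symm.trans (hy1 U (f.app U x)).symm)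
    have := (key _ _ U p U).1 (hp'.trans hq'.symm)
    rw [← hp, ← hq, this]
  · rintro U V h y ⟨x, hx⟩
    obtain ⟨p, -, -⟩ := aux_pb f _ V x _ (hx.trans (hy U V h y).symm)
    obtain ⟨q, hq⟩ := (key _ _ V p U).2 (𝟙 U.unop)
    refine ⟨(pullback.fst f _).app U q, ?_⟩
    rw [aux_pb_w, hq, hy1]

theorem isDisjointSummandInclusion_iff_representable_base_changes
    {T : Type u} [SmallCategory T] {X Y : PSh T} (f : X ⟶ Y) :
    (IsDisjointSummandInclusion f ↔
      ∀ (A : T) (t : yoneda.obj A ⟶ Y), IsDisjointSummandInclusion (pullback.snd f t)) ∧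
    (IsDisjointSummandInclusion f ↔
      ∀ (A : T) (t : yoneda.obj A ⟶ Y),
        IsIso (pullback.snd f t) ∨ Nonempty (IsInitial (pullback f t))) := by
  exact ⟨⟨fun h A t => aux_base f t h, fun h => aux_back f fun A t => aux_rep _ (h A t)⟩,
    ⟨fun h A t => aux_rep _ (aux_base f t h), aux_back f⟩⟩
end

section
/- Let T be a category and P an orbital wide subcategory of T. Then P is atomic orbital if and only if every morphism p : A → B of P that admits a section in T (a morphism s : B → A with p ∘ s = id_B) is an isomorphism. -/
open CategoryTheory CategoryTheory.Limits

universe u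

variable (T : Type u) [SmallCategory T]

variable {T}

section Helpers

theorem sigma_exists {n : ℕ} (A : Fin n → T) {U : T}
    (f : yoneda.obj U ⟶ ∐ fun i => yoneda.obj (A i)) :
    ∃ (i : Fin n) (g : U ⟶ A i), f = yoneda.map g ≫ Sigma.ι (fun i => yoneda.obj (A i)) i := by
  obtain ⟨⟨i⟩, y, hy⟩ := Types.jointly_surjective_of_isColimit
    (isColimitOfPreserves ((evaluation Tᵒᵖ (Type u)).obj (Opposite.op U))
      (coproductIsCoproduct fun i => yoneda.obj (A i))) (yonedaEquiv f)
  refine ⟨i, y, ?_⟩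
  apply yonedaEquiv.injective
  rw [← hy, yonedaEquiv_comp, yonedaEquiv_yoneda_map]
  rfl

/-- Explicit coproduct of presheaves. -/
def sigPsh {n : ℕ} (A : Fin n → T) : PSh T where
  obj U := Σ i, (U.unop ⟶ A i)
  map f := ↾fun x => ⟨x.1, f.unop ≫ x.2⟩

/-- Inclusions. -/
def sigInc {n : ℕ} (A : Fin n → T) (i : Fin n) : yoneda.obj (A i) ⟶ sigPsh A where
  app U := ↾fun x => ⟨i, x⟩

theorem sigma_inj {n : ℕ} (A : Fin n → T) {U : T} {i j : Fin n} (a : U ⟶ A i) (b : U ⟶ A j)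
    (h : yoneda.map a ≫ Sigma.ι (fun i => yoneda.obj (A i)) i =
      yoneda.map b ≫ Sigma.ι (fun i => yoneda.obj (A i)) j) :
    (⟨i, a⟩ : Σ i, (U ⟶ A i)) = ⟨j, b⟩ := by
  have h2 := congrArg (· ≫ Sigma.desc (sigInc A)) h
  simp only [Category.assoc, Sigma.ι_desc] at h2
  have h3 := congrArg yonedaEquiv h2
  rw [yonedaEquiv_comp, yonedaEquiv_comp, yonedaEquiv_yoneda_map, yonedaEquiv_yoneda_map] at h3
  exact h3

/-- Classifying presheaf. -/
def boolPsh (T : Type u) [SmallCategory T] : PSh T := (Functor.const _).obj (ULift.{u} Bool)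

/-- Constant maps. -/
def boolMap (X : PSh T) (b : Bool) : X ⟶ boolPsh T where
  app U := ↾fun _ => ⟨b⟩

theorem summand_closed {X Y : PSh T} (f : X ⟶ Y) (h : IsDisjointSummandInclusion f)
    {U V : T} (x : yoneda.obj U ⟶ Y) (v : V ⟶ U) (w : yoneda.obj V ⟶ X)
    (hx : yoneda.map v ≫ x = w ≫ f) : ∃ w', x = w' ≫ f := by
  obtain ⟨Z, g, ⟨hc⟩⟩ := h
  obtain ⟨χ, hl, hr⟩ : ∃ χ : Y ⟶ boolPsh T, f ≫ χ = boolMap X true ∧ g ≫ χ = boolMap Z false :=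
    ⟨BinaryCofan.IsColimit.desc hc (boolMap X true) (boolMap Z false),
      BinaryCofan.IsColimit.inl_desc hc (boolMap X true) (boolMap Z false),
      BinaryCofan.IsColimit.inr_desc hc (boolMap X true) (boolMap Z false)⟩
  have key : (∃ y : X.obj (Opposite.op U), f.app _ y = yonedaEquiv x) ∨
      (∃ y : Z.obj (Opposite.op U), g.app _ y = yonedaEquiv x) := by
    obtain ⟨⟨_ | _⟩, y, hy⟩ := Types.jointly_surjective_of_isColimit
      (isColimitOfPreserves ((evaluation Tᵒᵖ (Type u)).obj (Opposite.op U)) hc) (yonedaEquiv x)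
    · exact Or.inl ⟨y, hy⟩
    · exact Or.inr ⟨y, hy⟩
  obtain ⟨y, hy⟩ | ⟨y, hy⟩ := key
  · refine ⟨yonedaEquiv.symm y, yonedaEquiv.injective ?_⟩
    rw [yonedaEquiv_comp, Equiv.apply_symm_apply, ← hy]
  · exfalso
    have hx2 : x = yonedaEquiv.symm y ≫ g := yonedaEquiv.injective (by
      rw [yonedaEquiv_comp, Equiv.apply_symm_apply, ← hy])
    subst hx2
    have h2 : yoneda.map v ≫ yonedaEquiv.symm y ≫ boolMap Z false = w ≫ boolMap X true := by
      rw [← hl, ← hr, ← Category.assoc w, ← hx, Category.assoc, Category.assoc]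
    have h3 := congrArg yonedaEquiv h2
    rw [yonedaEquiv_comp, yonedaEquiv_comp] at h3
    have h4 := congrArg ULift.down h3
    exact Bool.noConfusion (h4 : false = true)

theorem summand_of_closed {X Y : PSh T} (f : X ⟶ Y) [Mono f]
    (h : ∀ {U V : T} (x : yoneda.obj U ⟶ Y) (v : V ⟶ U) (w : yoneda.obj V ⟶ X)
      (_ : yoneda.map v ≫ x = w ≫ f), ∃ w', x = w' ≫ f) : IsDisjointSummandInclusion f := by
  let S : Subfunctor Y :=
    { obj := fun U => (Set.range (f.app U))ᶜ
      map := by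
        rintro U V i x hx ⟨w, hw⟩
        apply hx
        obtain ⟨w', hw'⟩ := h (U := U.unop) (V := V.unop) (yonedaEquiv.symm x) i.unop
          (yonedaEquiv.symm w) (yonedaEquiv.injective (by
            rw [yonedaEquiv_comp, yonedaEquiv_comp, yonedaEquiv_yoneda_map,
              Equiv.apply_symm_apply]
            exact hw.symm))
        refine ⟨yonedaEquiv w', ?_⟩
        have := congrArg yonedaEquiv hw'
        rw [Equiv.apply_symm_apply, yonedaEquiv_comp] at this
        exact this.symm }
  refine ⟨S.toFunctor, S.ι, ⟨evaluationJointlyReflectsColimits _ fun U =>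
    (isColimitMapCoconeBinaryCofanEquiv _ _ _).symm (Nonempty.some ?_)⟩⟩
  rw [Types.binaryCofan_isColimit_iff]
  refine ⟨?_, ?_, ?_⟩
  · exact (mono_iff_injective (f.app U)).1 inferInstance
  · exact Subtype.val_injective
  · have : Set.range (S.ι.app U) = (Set.range (f.app U))ᶜ := Subtype.range_val
    change IsCompl (Set.range (f.app U)) (Set.range (S.ι.app U))
    rw [this]
    exact isCompl_compl

theorem memFinP_yoneda (P : MorphismProperty T) {A B : T} (p : A ⟶ B) (hp : P p) :
    MemFinP P (yoneda.map p) := by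
  have iso : ∀ C : T, IsIso (Sigma.ι (fun _ : Fin 1 => yoneda.obj C) 0) := fun C =>
    ⟨Sigma.desc fun _ => 𝟙 _, by simp, by
      apply Sigma.hom_ext
      intro i
      obtain rfl := Subsingleton.elim i 0
      simp⟩
  have := iso A
  have := iso B
  refine ⟨1, 1, fun _ => A, fun _ => B, fun _ => 0, fun _ => p, fun _ => hp,
    asIso (Sigma.ι (fun _ : Fin 1 => yoneda.obj A) 0),
    asIso (Sigma.ι (fun _ : Fin 1 => yoneda.obj B) 0), ?_⟩
  simp

end Helpers

/-!
Statement 6: an orbital wide subcategory `P` of `T` is atomic orbital if and only if every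
morphism of `P` admitting a section in `T` is an isomorphism.
-/

theorem isAtomicOrbital_iff_section_isIso
    {T : Type u} [SmallCategory T] (P : MorphismProperty T)
    (hwide : IsWideSubcategory P) (horb : IsOrbital P) :
    IsAtomicOrbital P ↔
      ∀ {A B : T} (p : A ⟶ B), P p → ∀ s : B ⟶ A, s ≫ p = 𝟙 B → IsIso p := by
  constructor
  · rintro ⟨-, h⟩ A B p hp s hs
    obtain ⟨w, hw⟩ := summand_closed _ (h p hp)
      (pullback.lift (f := yoneda.map p) (g := yoneda.map p) (𝟙 _) (yoneda.map (p ≫ s))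
        (by rw [← yoneda.map_comp]; simp [hs])) s (yoneda.map s) (by
          apply pullback.hom_ext
          · simp only [Category.assoc, pullback.lift_fst, pullback.diagonal_fst]
          · simp only [Category.assoc, pullback.lift_snd, pullback.diagonal_snd]
            rw [← yoneda.map_comp, reassoc_of% hs]
            simp)
    have h1 := congrArg (· ≫ pullback.fst _ _) hw
    have h2 := congrArg (· ≫ pullback.snd _ _) hw
    simp only [Category.assoc, pullback.lift_fst, pullback.lift_snd, pullback.diagonal_fst,
      pullback.diagonal_snd, Category.comp_id] at h1 h2
    refine ⟨s, yoneda.map_injective ?_, hs⟩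
    rw [h2, ← h1, yoneda.map_id]
  · intro h
    refine ⟨horb, fun {A B} p hp => ?_⟩
    have hfin : IsFiniteTSet (yoneda.obj A) := by
      obtain ⟨n, m, A', B', σ, p', -, eX, -⟩ := memFinP_yoneda P p hp
      exact ⟨n, A', ⟨eX⟩⟩
    obtain ⟨n, m, A', B', σ, p', hp', eX, eY, he⟩ :=
      horb (yoneda.map p) (yoneda.map p) (memFinP_yoneda P p hp) hfin
    obtain ⟨i₀, d, hd⟩ := sigma_exists A' (pullback.diagonal (yoneda.map p) ≫ eX.hom)
    have hY : eY.hom = yoneda.map (d ≫ p' i₀) ≫ Sigma.ι (fun j => yoneda.obj (B' j)) (σ i₀) := by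
      have := congrArg (pullback.diagonal (yoneda.map p) ≫ ·) he
      simp only [pullback.diagonal_snd_assoc] at this
      rw [this, reassoc_of% hd]
      simp
    obtain ⟨b, hb⟩ := yoneda.map_surjective (Sigma.ι (fun j => yoneda.obj (B' j)) (σ i₀) ≫ eY.inv)
    have hb1 : (d ≫ p' i₀) ≫ b = 𝟙 A := yoneda.map_injective (by
      rw [yoneda.map_comp, hb, ← Category.assoc, ← hY]; simp)
    have hb2 : b ≫ (d ≫ p' i₀) = 𝟙 _ := by
      have := sigma_inj B' (i := σ i₀) (j := σ i₀) (b ≫ (d ≫ p' i₀)) (𝟙 _) (by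
        rw [yoneda.map_comp, Category.assoc, ← hY, hb]; simp)
      simpa using this
    have hbi : IsIso b := ⟨_, hb2, hb1⟩
    have hq : IsIso (p' i₀ ≫ b) :=
      h _ (hwide.2 _ _ (hp' i₀) (hwide.1 _ hbi)) d (by simpa using hb1)
    have hdi : IsIso d := by
      have : IsIso (d ≫ p' i₀ ≫ b) := by
        rw [← Category.assoc, hb1]; infer_instance
      exact IsIso.of_isIso_comp_right d (p' i₀ ≫ b)
    apply summand_of_closed
    intro U V x v w hx
    obtain ⟨i, x', hx'⟩ := sigma_exists A' (x ≫ eX.hom)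
    obtain ⟨w₀, rfl⟩ := yoneda.map_surjective w
    have key := sigma_inj A' (v ≫ x') (w₀ ≫ d) (by
      rw [yoneda.map_comp, yoneda.map_comp, Category.assoc, Category.assoc, ← hx', ← hd,
        reassoc_of% hx])
    obtain rfl : i = i₀ := congrArg Sigma.fst key
    refine ⟨yoneda.map (x' ≫ inv d), ?_⟩
    rw [← cancel_mono eX.hom, hx', Category.assoc, hd, ← Category.assoc, ← yoneda.map_comp]
    simp
end

section
/- Let T be a category, P an atomic orbital wide subcategory of T, Y a presheaf of sets on T, and p : X ⟶ Y a morphism of presheaves lying in 𝔽̲^P(Y). Then the diagonal Δ_p : X ⟶ X ×_Y X in PSh(T) is a disjoint summand inclusion. -/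
open CategoryTheory CategoryTheory.Limits

universe u

variable (T : Type u) [SmallCategory T]

variable {T}

/-- A morphism of presheaves `p : X ⟶ Y` lies in `𝔽̲^P(Y)` if all of its base changes to
representables lie in `𝔽^P`. -/
def MemFinPFamily (P : MorphismProperty T) {X Y : PSh T} (p : X ⟶ Y) : Prop :=
  ∀ (B : T) (β : yoneda.obj B ⟶ Y), MemFinP P (pullback.snd p β)

/-- Elementary form of the diagonal being a complemented subpresheaf. -/
def Unram {X Y : PSh T} (p : X ⟶ Y) : Prop :=
  ∀ {A B : T} (u : A ⟶ B) (x y : yoneda.obj B ⟶ X), x ≫ p = y ≫ p →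
    yoneda.map u ≫ x = yoneda.map u ≫ y → x = y

theorem dsi_cond {X Y : PSh T} {f : X ⟶ Y} (h : IsDisjointSummandInclusion f)
    {A B : Tᵒᵖ} (u : A ⟶ B) (y : Y.obj A) (hy : Y.map u y ∈ Set.range (f.app B)) :
    y ∈ Set.range (f.app A) := by
  obtain ⟨Z, g, ⟨hc⟩⟩ := h
  have key : ∀ C : Tᵒᵖ, IsCompl (Set.range (f.app C)) (Set.range (g.app C)) := fun C =>
    ((Types.binaryCofan_isColimit_iff _).1
      ⟨mapIsColimitOfPreservesOfIsColimit ((evaluation Tᵒᵖ (Type u)).obj C) f g hc⟩).2.2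
  by_contra hn
  have h1 : y ∈ Set.range (g.app A) := by
    have := (key A).compl_eq
    rw [← this]; exact hn
  obtain ⟨z, rfl⟩ := h1
  have h2 : Y.map u (g.app A z) ∈ Set.range (g.app B) :=
    ⟨Z.map u z, NatTrans.naturality_apply g u z⟩
  exact (Set.disjoint_left.1 (key B).disjoint) hy h2

/-- Complement presheaf. -/
def complPSh {X Y : PSh T} (f : X ⟶ Y)
    (hf : ∀ {A B : Tᵒᵖ} (u : A ⟶ B) (y : Y.obj A), Y.map u y ∈ Set.range (f.app B) →
      y ∈ Set.range (f.app A)) : Subfunctor Y where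
  obj C := (Set.range (f.app C))ᶜ
  map u := fun y hy h => hy (hf u y h)

theorem dsi_of_cond {X Y : PSh T} (f : X ⟶ Y) (hi : ∀ C, Function.Injective (f.app C))
    (hf : ∀ {A B : Tᵒᵖ} (u : A ⟶ B) (y : Y.obj A), Y.map u y ∈ Set.range (f.app B) →
      y ∈ Set.range (f.app A)) : IsDisjointSummandInclusion f := by
  refine ⟨(complPSh f hf).toFunctor, (complPSh f hf).ι, ⟨?_⟩⟩
  refine evaluationJointlyReflectsColimits _ fun C => ?_
  refine (isColimitMapCoconeBinaryCofanEquiv ((evaluation Tᵒᵖ (Type u)).obj C) _ _).symm ?_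
  refine Nonempty.some ((Types.binaryCofan_isColimit_iff _).2 ⟨hi C, ?_, ?_⟩)
  · exact Subtype.val_injective
  · have : Set.range ((complPSh f hf).ι.app C) = (Set.range (f.app C))ᶜ :=
      Subtype.range_val
    change IsCompl (Set.range (f.app C)) (Set.range ((complPSh f hf).ι.app C))
    rw [this]
    exact isCompl_compl

theorem dsi_of_unram {X Y : PSh T} (p : X ⟶ Y) (h : Unram p) :
    IsDisjointSummandInclusion (pullback.diagonal p) := by
  refine dsi_of_cond _ (fun C => ?_) ?_
  · exact (mono_iff_injective _).1 inferInstance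
  · rintro A B u y ⟨x, hx⟩
    obtain ⟨t, rfl⟩ := yonedaEquiv.surjective y
    obtain ⟨s, rfl⟩ := yonedaEquiv.surjective x
    have e : s ≫ pullback.diagonal p = yoneda.map u.unop ≫ t := by
      apply yonedaEquiv.injective
      rw [yonedaEquiv_comp, hx]
      exact yonedaEquiv_naturality t u.unop
    have e1 := congr($e ≫ pullback.fst p p)
    have e2 := congr($e ≫ pullback.snd p p)
    simp only [Category.assoc, pullback.diagonal_fst, pullback.diagonal_snd] at e1 e2
    have := h u.unop (t ≫ pullback.fst p p) (t ≫ pullback.snd p p)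
      (by simp [pullback.condition]) (e1.symm.trans e2)
    refine ⟨yonedaEquiv (t ≫ pullback.fst p p), ?_⟩
    erw [← yonedaEquiv_comp]
    congr 1
    apply pullback.hom_ext <;> simp [this]

theorem unram_of_dsi {X Y : PSh T} (p : X ⟶ Y)
    (h : IsDisjointSummandInclusion (pullback.diagonal p)) : Unram p := by
  intro A B u x y h1 h2
  obtain ⟨l, hl1, hl2⟩ : ∃ l : yoneda.obj B ⟶ pullback.diagonalObj p,
      l ≫ pullback.fst p p = x ∧ l ≫ pullback.snd p p = y :=
    ⟨pullback.lift x y h1, pullback.lift_fst _ _ _, pullback.lift_snd _ _ _⟩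
  obtain ⟨s, hs⟩ := dsi_cond h u.op (yonedaEquiv l)
    ⟨yonedaEquiv (yoneda.map u ≫ x), by
      erw [← yonedaEquiv_comp, yonedaEquiv_naturality]
      congr 1
      apply pullback.hom_ext <;> simp [h2, hl1, hl2]⟩
  obtain ⟨s, rfl⟩ := yonedaEquiv.surjective s
  erw [← yonedaEquiv_comp] at hs
  have hs := yonedaEquiv.injective hs
  have e1 := congr($hs ≫ pullback.fst p p)
  have e2 := congr($hs ≫ pullback.snd p p)
  simp [hl1, hl2] at e1 e2
  exact e1.symm.trans e2

/-- Explicit model of a coproduct of representables. -/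
def sigPSh {n : ℕ} (A : Fin n → T) : PSh T where
  obj C := Σ i, (C.unop ⟶ A i)
  map u := ↾fun x => ⟨x.1, u.unop ≫ x.2⟩

/-- Comparison. -/
noncomputable def toSig {n : ℕ} (A : Fin n → T) : (∐ fun i => yoneda.obj (A i)) ⟶ sigPSh A :=
  Sigma.desc fun i => { app := fun C => ↾fun a => ⟨i, a⟩ }

theorem sig_inj {n : ℕ} (A : Fin n → T) {C : T} {i j : Fin n} (a : C ⟶ A i) (b : C ⟶ A j)
    (h : yoneda.map a ≫ Sigma.ι (fun i => yoneda.obj (A i)) i =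
      yoneda.map b ≫ Sigma.ι (fun i => yoneda.obj (A i)) j) :
    (⟨i, a⟩ : Σ i, (C ⟶ A i)) = ⟨j, b⟩ := by
  have h := congr(yonedaEquiv ($h ≫ toSig A))
  simp only [toSig, Category.assoc, colimit.ι_desc, Cofan.mk_ι_app] at h
  have h' : (⟨i, 𝟙 C ≫ a⟩ : Σ i, (C ⟶ A i)) = ⟨j, 𝟙 C ≫ b⟩ := h
  simpa only [Category.id_comp] using h'

theorem sig_surj {n : ℕ} (A : Fin n → T) {C : T} (x : yoneda.obj C ⟶ ∐ fun i => yoneda.obj (A i)) :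
    ∃ (i : Fin n) (a : C ⟶ A i), x = yoneda.map a ≫ Sigma.ι (fun i => yoneda.obj (A i)) i := by
  obtain ⟨⟨i⟩, a, ha⟩ := FunctorToTypes.jointly_surjective _ _
    (colimit.isColimit (Discrete.functor fun i => yoneda.obj (A i))) (yonedaEquiv x)
  refine ⟨i, a, yonedaEquiv.injective ?_⟩
  rw [yonedaEquiv_comp, yonedaEquiv_yoneda_map]
  exact ha

theorem unram_of_memFinP {P : MorphismProperty T}
    (hP : ∀ {A B : T} (p : A ⟶ B), P p → Unram (yoneda.map p))
    {X Y : PSh T} (f : X ⟶ Y) (h : MemFinP P f) : Unram f := by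
  obtain ⟨n, m, A, B, σ, p, hp, eX, eY, e⟩ := h
  intro C D u x y h1 h2
  rw [← cancel_mono eX.hom]
  obtain ⟨i, a, ha⟩ := sig_surj A (x ≫ eX.hom)
  obtain ⟨j, b, hb⟩ := sig_surj A (y ≫ eX.hom)
  have h2 := congr($h2 ≫ eX.hom)
  simp only [Category.assoc, ha, hb] at h2
  rw [← Category.assoc, ← Category.assoc, ← Functor.map_comp, ← Functor.map_comp] at h2
  have h2 := sig_inj A _ _ h2
  obtain ⟨rfl, h2⟩ := Sigma.mk.inj_iff.1 h2
  have h2 := eq_of_heq h2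
  have h1 := congr($h1 ≫ eY.hom)
  simp only [Category.assoc, e] at h1
  rw [← Category.assoc, ← Category.assoc, ha, hb] at h1
  simp only [Category.assoc, colimit.ι_desc, Cofan.mk_ι_app] at h1
  rw [← Category.assoc, ← Category.assoc, ← Functor.map_comp, ← Functor.map_comp] at h1
  have h1 := eq_of_heq (Sigma.mk.inj_iff.1 (sig_inj B _ _ h1)).2
  have := hP (p i) (hp i) u (yoneda.map a) (yoneda.map b)
    (by rw [← Functor.map_comp, ← Functor.map_comp, h1])
    (by rw [← Functor.map_comp, ← Functor.map_comp, h2])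
  rw [ha, hb, this]

theorem diagonal_isDisjointSummandInclusion_of_memFinPFamily
    {T : Type u} [SmallCategory T] (P : MorphismProperty T)
    (hwide : IsWideSubcategory P) (hatomic : IsAtomicOrbital P)
    {X Y : PSh T} (p : X ⟶ Y) (hp : MemFinPFamily P p) :
    IsDisjointSummandInclusion (pullback.diagonal p) := by
  apply dsi_of_unram
  intro A B u x y h1 h2
  have H : Unram (pullback.snd p (x ≫ p)) := unram_of_memFinP (fun q hq => unram_of_dsi _ (hatomic.2 q hq)) _ (hp B (x ≫ p))
  have ex : ∀ z : yoneda.obj B ⟶ X, z ≫ p = x ≫ p →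
      ∃ l : yoneda.obj B ⟶ pullback p (x ≫ p),
        l ≫ pullback.fst p (x ≫ p) = z ∧ l ≫ pullback.snd p (x ≫ p) = 𝟙 _ := fun z hz =>
    ⟨pullback.lift z (𝟙 _) (hz.trans (Category.id_comp _).symm),
      pullback.lift_fst _ _ _, pullback.lift_snd _ _ _⟩
  obtain ⟨l, hl1, hl2⟩ := ex x rfl
  obtain ⟨k, hk1, hk2⟩ := ex y h1.symm
  have := H u l k (hl2.trans hk2.symm)
    (by apply pullback.hom_ext <;> simp [h2, hl1, hl2, hk1, hk2])
  rw [← hl1, ← hk1, this]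
end

section
/- Let T be a category, P an atomic orbital wide subcategory of T, and p : A ⟶ B a morphism between finite T-sets lying in 𝔽^P. Then for all morphisms of presheaves f : X ⟶ A and g : Y ⟶ A, the canonical morphism X ×_A Y ⟶ X ×_B Y (induced by the identities of X and Y, viewing X and Y as presheaves over B via composition with p) is a disjoint summand inclusion. -/
open CategoryTheory CategoryTheory.Limits

universe u

variable (T : Type u) [SmallCategory T]

variable {T}

/-- Detection of equality along restriction. -/
def HelperD {A B : PSh T} (p : A ⟶ B) : Prop :=
  ∀ (U V : Tᵒᵖ) (φ : V ⟶ U) (a a' : A.obj V), p.app V a = p.app V a' →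
    A.map φ a = A.map φ a' → a = a'

lemma helper_pb_ext {X Y A : PSh T} (f : X ⟶ A) (g : Y ⟶ A) (V : Tᵒᵖ)
    (z w : (pullback f g).obj V)
    (h1 : (pullback.fst f g).app V z = (pullback.fst f g).app V w)
    (h2 : (pullback.snd f g).app V z = (pullback.snd f g).app V w) : z = w :=
  Types.ext_of_isPullback ((IsPullback.of_hasPullback f g).map ((evaluation _ _).obj V)) h1 h2

lemma helper_pb_exists {X Y A : PSh T} (f : X ⟶ A) (g : Y ⟶ A) (V : Tᵒᵖ)
    (x : X.obj V) (y : Y.obj V) (h : f.app V x = g.app V y) :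
    ∃ z : (pullback f g).obj V,
      (pullback.fst f g).app V z = x ∧ (pullback.snd f g).app V z = y :=
  Types.exists_of_isPullback
    ((IsPullback.of_hasPullback f g).map ((evaluation _ _).obj V)) x y h

lemma helper_dsi_mp {X Y : PSh T} (f : X ⟶ Y) (h : IsDisjointSummandInclusion f)
    (U V : Tᵒᵖ) (φ : V ⟶ U) (y : Y.obj V) (x : X.obj U) (hx : f.app U x = Y.map φ y) :
    ∃ x', f.app V x' = y := by
  obtain ⟨Z, g, ⟨hc⟩⟩ := h
  have key : ∀ W : Tᵒᵖ, IsCompl (Set.range (f.app W)) (Set.range (g.app W)) := fun W =>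
    ((Types.binaryCofan_isColimit_iff _).mp
      ⟨mapIsColimitOfPreservesOfIsColimit ((evaluation _ (Type u)).obj W) f g hc⟩).2.2
  have hy : y ∈ Set.range (f.app V) ⊔ Set.range (g.app V) := by
    rw [(key V).sup_eq_top]; trivial
  rcases hy with hy | ⟨z, rfl⟩
  · exact hy
  · exfalso
    refine Set.disjoint_left.mp (key U).disjoint ⟨x, rfl⟩ ⟨Z.map φ z, ?_⟩
    rw [hx]
    exact NatTrans.naturality_apply g φ z

lemma helper_dsi_mpr {X Y : PSh T} (f : X ⟶ Y)
    (hinj : ∀ V, Function.Injective (f.app V))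
    (h : ∀ (U V : Tᵒᵖ) (φ : V ⟶ U) (y : Y.obj V) (x : X.obj U), f.app U x = Y.map φ y →
      ∃ x', f.app V x' = y) : IsDisjointSummandInclusion f := by
  let S : Subfunctor Y :=
    { obj := fun V => (Set.range (f.app V))ᶜ
      map := by
        rintro V U φ y hy ⟨x, hx⟩
        exact hy (h U V φ y x hx) }
  refine ⟨S.toFunctor, S.ι, ⟨evaluationJointlyReflectsColimits _ fun V => ?_⟩⟩
  refine (isColimitMapCoconeBinaryCofanEquiv ((evaluation _ (Type u)).obj V) f S.ι).symm ?_
  refine ((Types.binaryCofan_isColimit_iff _).mpr ⟨hinj V, ?_, ?_⟩).some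
  · exact Subtype.val_injective
  · have : Set.range (S.ι.app V) = (Set.range (f.app V))ᶜ := Subtype.range_val
    change IsCompl (Set.range (f.app V)) (Set.range (S.ι.app V))
    rw [this]
    exact isCompl_compl

lemma helper_D_of_diag {A B : PSh T} (p : A ⟶ B)
    (h : IsDisjointSummandInclusion (pullback.diagonal p)) : HelperD p := by
  intro U V φ a a' h1 h2
  obtain ⟨z, rfl, rfl⟩ := helper_pb_exists p p V a a' h1
  have e1 : ∀ W (x : A.obj W), (pullback.fst p p).app W ((pullback.diagonal p).app W x) = x :=
    fun W x => by rw [← NatTrans.comp_app_apply, pullback.diagonal_fst]; rfl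
  have e2 : ∀ W (x : A.obj W), (pullback.snd p p).app W ((pullback.diagonal p).app W x) = x :=
    fun W x => by rw [← NatTrans.comp_app_apply, pullback.diagonal_snd]; rfl
  obtain ⟨x, rfl⟩ := helper_dsi_mp _ h U V φ z (A.map φ ((pullback.fst p p).app V z)) (by
    apply helper_pb_ext
    · rw [e1]; exact (NatTrans.naturality_apply (pullback.fst p p) φ z).symm
    · rw [e2, h2]; exact (NatTrans.naturality_apply (pullback.snd p p) φ z).symm)
  rw [e1, e2]

/-- Explicit model of a coproduct of representables. -/
def helperSig {n : ℕ} (A : Fin n → T) : PSh T where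
  obj V := Σ i, (V.unop ⟶ A i)
  map φ := ↾fun x => ⟨x.1, φ.unop ≫ x.2⟩

/-- Comparison with the explicit model. -/
noncomputable def helperToSig {n : ℕ} (A : Fin n → T) :
    (∐ fun i => yoneda.obj (A i)) ⟶ helperSig A :=
  Sigma.desc fun i => { app := fun V => ↾fun x => ⟨i, x⟩ }

lemma helperToSig_ι {n : ℕ} (A : Fin n → T) (i : Fin n) (V : Tᵒᵖ) (x : V.unop ⟶ A i) :
    (helperToSig A).app V ((Sigma.ι (fun i => yoneda.obj (A i)) i).app V x) = ⟨i, x⟩ := by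
  rw [← NatTrans.comp_app_apply, helperToSig, Sigma.ι_desc]; rfl

lemma helper_surj {n : ℕ} (A : Fin n → T) (V : Tᵒᵖ) (a : (∐ fun i => yoneda.obj (A i)).obj V) :
    ∃ (i : Fin n) (x : V.unop ⟶ A i), (Sigma.ι (fun i => yoneda.obj (A i)) i).app V x = a := by
  obtain ⟨⟨i⟩, x, hx⟩ := Types.jointly_surjective_of_isColimit
    (isColimitOfPreserves ((evaluation _ (Type u)).obj V)
      (colimit.isColimit (Discrete.functor fun i => yoneda.obj (A i)))) a
  exact ⟨i, x, hx⟩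

lemma helper_D_sigma {n m : ℕ} (A : Fin n → T) (B : Fin m → T) (σ : Fin n → Fin m)
    (p : ∀ i, A i ⟶ B (σ i)) (h : ∀ i, HelperD (yoneda.map (p i))) :
    HelperD (Sigma.desc fun i =>
          yoneda.map (p i) ≫ Sigma.ι (fun j => yoneda.obj (B j)) (σ i)) := by
  intro U V φ a a' h1 h2
  obtain ⟨i, x, rfl⟩ := helper_surj A V a
  obtain ⟨j, y, rfl⟩ := helper_surj A V a'
  have e : ∀ k (z : V.unop ⟶ A k), (Sigma.desc fun i =>
      yoneda.map (p i) ≫ Sigma.ι (fun j => yoneda.obj (B j)) (σ i)).app V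
        ((Sigma.ι (fun i => yoneda.obj (A i)) k).app V z) =
      (Sigma.ι (fun j => yoneda.obj (B j)) (σ k)).app V (z ≫ p k) := fun k z => by
    rw [← NatTrans.comp_app_apply, Sigma.ι_desc]; rfl
  have e' : ∀ k (z : V.unop ⟶ A k), (∐ fun i => yoneda.obj (A i)).map φ
        ((Sigma.ι (fun i => yoneda.obj (A i)) k).app V z) =
      (Sigma.ι (fun j => yoneda.obj (A j)) k).app U (φ.unop ≫ z) := fun k z =>
    (NatTrans.naturality_apply (Sigma.ι (fun j => yoneda.obj (A j)) k) φ z).symm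
  erw [e, e] at h1
  erw [e', e'] at h2
  replace h2 := congrArg ((helperToSig A).app U) h2
  replace h1 := congrArg ((helperToSig B).app V) h1
  erw [helperToSig_ι, helperToSig_ι] at h1 h2
  obtain rfl : i = j := congrArg Sigma.fst h2
  have h1' := eq_of_heq (Sigma.mk.inj h1).2
  have h2' := eq_of_heq (Sigma.mk.inj h2).2
  rw [h i U V φ x y h1' h2']

lemma helper_D_of_mem (P : MorphismProperty T) (hatomic : IsAtomicOrbital P)
    {A B : PSh T} (p : A ⟶ B) (hp : MemFinP P p) : HelperD p := by
  obtain ⟨n, m, A', B', σ, q, hq, eX, eY, h⟩ := hp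
  have hD := helper_D_sigma A' B' σ q fun i => helper_D_of_diag _ (hatomic.2 _ (hq i))
  intro U V φ a a' h1 h2
  have hinj : Function.Injective (eX.hom.app V) :=
    (mono_iff_injective _).mp inferInstance
  apply hinj
  apply hD U V φ
  · rw [← NatTrans.comp_app_apply, ← NatTrans.comp_app_apply, ← h,
      NatTrans.comp_app_apply, NatTrans.comp_app_apply, h1]
  · rw [← NatTrans.naturality_apply, ← NatTrans.naturality_apply, h2]

/-!
Statement 9: for an atomic orbital wide subcategory `P` of `T`, a morphism `p : A ⟶ B` of
finite `T`-sets lying in `𝔽^P` and morphisms of presheaves `f : X ⟶ A` and `g : Y ⟶ A`,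
the canonical morphism `X ×_A Y ⟶ X ×_B Y` is a disjoint summand inclusion.
-/

theorem pullback_comparison_isDisjointSummandInclusion
    {T : Type u} [SmallCategory T] (P : MorphismProperty T)
    (hwide : IsWideSubcategory P) (hatomic : IsAtomicOrbital P)
    {A B X Y : PSh T} (p : A ⟶ B) (hp : MemFinP P p) (f : X ⟶ A) (g : Y ⟶ A) :
    IsDisjointSummandInclusion
      (pullback.map f g (f ≫ p) (g ≫ p) (𝟙 X) (𝟙 Y) p (by simp) (by simp)) := by
  have hD := helper_D_of_mem P hatomic p hp
  set c := pullback.map f g (f ≫ p) (g ≫ p) (𝟙 X) (𝟙 Y) p (by simp) (by simp) with hc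
  have e1 : ∀ W z, (pullback.fst (f ≫ p) (g ≫ p)).app W (c.app W z) =
      (pullback.fst f g).app W z := fun W z => by
    rw [← NatTrans.comp_app_apply, hc, pullback.lift_fst, Category.comp_id]
  have e2 : ∀ W z, (pullback.snd (f ≫ p) (g ≫ p)).app W (c.app W z) =
      (pullback.snd f g).app W z := fun W z => by
    rw [← NatTrans.comp_app_apply, hc, pullback.lift_snd, Category.comp_id]
  have cond : ∀ {X Y A : PSh T} (f : X ⟶ A) (g : Y ⟶ A) (W) (z : (pullback f g).obj W),
      f.app W ((pullback.fst f g).app W z) = g.app W ((pullback.snd f g).app W z) :=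
    fun f g W z => by
      rw [← NatTrans.comp_app_apply, pullback.condition, NatTrans.comp_app_apply]
  apply helper_dsi_mpr
  · intro V z w hzw
    apply helper_pb_ext
    · rw [← e1, ← e1, hzw]
    · rw [← e2, ← e2, hzw]
  · intro U V φ y x hx
    have hy : f.app V ((pullback.fst (f ≫ p) (g ≫ p)).app V y) =
        g.app V ((pullback.snd (f ≫ p) (g ≫ p)).app V y) := by
      apply hD U V φ
      · have := cond (f ≫ p) (g ≫ p) V y
        rwa [NatTrans.comp_app_apply, NatTrans.comp_app_apply] at this
      · rw [← NatTrans.naturality_apply, ← NatTrans.naturality_apply,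
          ← NatTrans.naturality_apply, ← NatTrans.naturality_apply, ← hx, e1, e2]
        exact cond f g U x
    obtain ⟨z, h1, h2⟩ := helper_pb_exists f g V _ _ hy
    refine ⟨z, helper_pb_ext _ _ _ _ _ ?_ ?_⟩
    · rw [e1, h1]
    · rw [e2, h2]
end

section
/- Let T be a category, P an atomic orbital wide subcategory of T, B an object of T, and p : Y ⟶ y(B) a morphism of finite T-sets lying in 𝔽^P. Then every section s : y(B) ⟶ Y of p is a disjoint summand inclusion. Consequently, every such triple (Y, p, s) is isomorphic, compatibly over and under y(B), to one of the form (X ⨿ y(B), (q, id_{y(B)}), coproduct inclusion of y(B)) for some finite T-set X and morphism q : X ⟶ y(B) lying in 𝔽^P; i.e. every finite pointed P-set over B is obtained by adjoining a disjoint basepoint to a finite P-set over B. -/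
open CategoryTheory CategoryTheory.Limits

universe u

variable (T : Type u) [SmallCategory T]

variable {T}

/-!
Statement 10: for an atomic orbital wide subcategory `P` of `T`, an object `B` of `T` and a
morphism `p : Y ⟶ y(B)` of finite `T`-sets lying in `𝔽^P`, every section `s` of `p` is a
disjoint summand inclusion; consequently `(Y, p, s)` is isomorphic over and under `y(B)` to
a triple `(X ⨿ y(B), (q, id), inr)` with `q : X ⟶ y(B)` in `𝔽^P`: every finite pointed
`P`-set over `B` is obtained by adjoining a disjoint basepoint to a finite `P`-set over `B`.
-/

lemma aux_bin {T : Type u} [SmallCategory T] {X Z Y : PSh T} {f : X ⟶ Y} {g : Z ⟶ Y}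
    (h : IsColimit (BinaryCofan.mk f g)) {C : T} :
    (∀ φ : yoneda.obj C ⟶ Y, (∃ ψ, ψ ≫ f = φ) ∨ (∃ ψ, ψ ≫ g = φ)) ∧
    (∀ (ψ : yoneda.obj C ⟶ X) (χ : yoneda.obj C ⟶ Z), ψ ≫ f ≠ χ ≫ g) := by
  have h1 := mapIsColimitOfPreservesOfIsColimit
    ((evaluation Tᵒᵖ (Type u)).obj (Opposite.op C)) f g h
  obtain ⟨-, -, h2⟩ := (Types.binaryCofan_isColimit_iff _).1 ⟨h1⟩
  constructor
  · intro φ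
    have h3 := h2.sup_eq_top.ge (Set.mem_univ (yonedaEquiv φ))
    rcases h3 with ⟨x, hx⟩ | ⟨x, hx⟩
    · change X.obj (Opposite.op C) at x
      refine Or.inl ⟨yonedaEquiv.symm x, ?_⟩
      apply yonedaEquiv.injective
      rw [yonedaEquiv_comp, Equiv.apply_symm_apply]
      exact hx
    · change Z.obj (Opposite.op C) at x
      refine Or.inr ⟨yonedaEquiv.symm x, ?_⟩
      apply yonedaEquiv.injective
      rw [yonedaEquiv_comp, Equiv.apply_symm_apply]
      exact hx
  · intro ψ χ e
    have e' := congrArg yonedaEquiv e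
    rw [yonedaEquiv_comp, yonedaEquiv_comp] at e'
    exact Set.disjoint_left.1 h2.disjoint ⟨yonedaEquiv ψ, rfl⟩ ⟨yonedaEquiv χ, e'.symm⟩

lemma aux_sec {T : Type u} [SmallCategory T] {A B : T} (r : A ⟶ B) (a : B ⟶ A)
    (har : a ≫ r = 𝟙 B) (h : IsDisjointSummandInclusion (pullback.diagonal (yoneda.map r))) :
    r ≫ a = 𝟙 A := by
  obtain ⟨Z, g, ⟨hc⟩⟩ := h
  let φ : yoneda.obj A ⟶ pullback (yoneda.map r) (yoneda.map r) :=
    pullback.lift (𝟙 _) (yoneda.map (r ≫ a)) (by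
      rw [← Functor.map_comp, Category.assoc, har]; simp)
  rcases (aux_bin hc).1 φ with ⟨ψ, hψ⟩ | ⟨ψ, hψ⟩
  · have h1 := congrArg (· ≫ pullback.fst _ _) hψ
    have h2 := congrArg (· ≫ pullback.snd _ _) hψ
    simp only [φ, Category.assoc, pullback.diagonal_fst, pullback.diagonal_snd,
      pullback.lift_fst, pullback.lift_snd, Category.comp_id] at h1 h2
    apply yoneda.map_injective
    rw [← h2, h1, CategoryTheory.Functor.map_id]
  · exfalso
    refine (aux_bin hc).2 (yoneda.map a) (yoneda.map a ≫ ψ) ?_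
    rw [Category.assoc, hψ]
    apply pullback.hom_ext
    · simp only [φ, Category.assoc, pullback.diagonal_fst, pullback.lift_fst]
    · simp only [φ, Category.assoc, pullback.diagonal_snd, pullback.lift_snd, Category.comp_id]
      rw [← Functor.map_comp, ← Category.assoc, har, Category.id_comp]

lemma aux_sigma {T : Type u} [SmallCategory T] {n : ℕ} (A : Fin n → T) {C : T}
    (φ : yoneda.obj C ⟶ ∐ fun i => yoneda.obj (A i)) :
    ∃ (i : Fin n) (a : C ⟶ A i), φ = yoneda.map a ≫ Sigma.ι (fun i => yoneda.obj (A i)) i := by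
  have h1 := isColimitOfHasCoproductOfPreservesColimit
    ((evaluation Tᵒᵖ (Type u)).obj (Opposite.op C)) (fun i => yoneda.obj (A i))
  obtain ⟨i, a, ha⟩ := Cofan.inj_jointly_surjective_of_isColimit h1 (yonedaEquiv φ)
  refine ⟨i, a, yonedaEquiv.injective ?_⟩
  rw [yonedaEquiv_comp, yonedaEquiv_yoneda_map]
  exact ha.symm

lemma aux_disj {T : Type u} [SmallCategory T] {n : ℕ} (A : Fin n → T) {C : T} {i j : Fin n}
    (a : C ⟶ A i) (b : C ⟶ A j)
    (h : yoneda.map a ≫ Sigma.ι (fun i => yoneda.obj (A i)) i =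
      yoneda.map b ≫ Sigma.ι (fun i => yoneda.obj (A i)) j) : i = j := by
  have h1 := isColimitOfHasCoproductOfPreservesColimit
    ((evaluation Tᵒᵖ (Type u)).obj (Opposite.op C)) (fun i => yoneda.obj (A i))
  have h2 := congrArg yonedaEquiv h
  rw [yonedaEquiv_comp, yonedaEquiv_yoneda_map, yonedaEquiv_comp, yonedaEquiv_yoneda_map] at h2
  have := Cofan.eq_of_inj_apply_eq_of_isColimit h1 (i₁ := i) (i₂ := j) a b h2
  exact this

lemma aux_norm {T : Type u} [SmallCategory T] (P : MorphismProperty T)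
    (hwide : IsWideSubcategory P) {B : T} {Y : PSh T} (p : Y ⟶ yoneda.obj B)
    (hp : MemFinP P p) : ∃ (n : ℕ) (A : Fin n → T) (r : ∀ i, A i ⟶ B), (∀ i, P (r i)) ∧
      ∃ e : Y ≅ ∐ fun i => yoneda.obj (A i), p = e.hom ≫ Sigma.desc fun i => yoneda.map (r i) := by
  obtain ⟨n, m, A, B', σ, p', hp', eX, eY, h⟩ := hp
  obtain ⟨j0, b, hb⟩ := aux_sigma B' eY.hom
  let c : ∀ j, B' j ⟶ B := fun j =>
    yoneda.preimage (Sigma.ι (fun j => yoneda.obj (B' j)) j ≫ eY.inv)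
  have hc : ∀ j, yoneda.map (c j) = Sigma.ι (fun j => yoneda.obj (B' j)) j ≫ eY.inv :=
    fun j => yoneda.map_preimage _
  have key : ∀ j, yoneda.map (c j ≫ b) ≫ Sigma.ι (fun j => yoneda.obj (B' j)) j0 =
      yoneda.map (𝟙 (B' j)) ≫ Sigma.ι (fun j => yoneda.obj (B' j)) j := by
    intro j
    rw [Functor.map_comp, Category.assoc, ← hb, hc]; simp
  have hiso : ∀ j, IsIso (c j) := by
    intro j
    obtain rfl := aux_disj B' _ _ (key j)
    refine ⟨b, ?_, ?_⟩
    · apply yoneda.map_injective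
      exact (cancel_mono _).1 (key _)
    · apply yoneda.map_injective
      rw [Functor.map_comp, hc, ← Category.assoc, ← hb]; simp
  refine ⟨n, A, fun i => p' i ≫ c (σ i), fun i => hwide.2 _ _ (hp' i) (hwide.1 _ (hiso _)), eX, ?_⟩
  rw [← cancel_mono eY.hom, h, Category.assoc]
  congr 1
  apply Sigma.hom_ext
  intro i
  simp [hc]

lemma aux_mem {T : Type u} [SmallCategory T] (P : MorphismProperty T)
    {B : T} {n : ℕ} (A : Fin n → T) (r : ∀ i, A i ⟶ B) (hr : ∀ i, P (r i)) :
    MemFinP P (Sigma.desc fun i => yoneda.map (r i)) := by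
  refine ⟨n, 1, A, fun _ => B, fun _ => 0, r, hr, Iso.refl _,
    ⟨Sigma.ι (fun _ : Fin 1 => yoneda.obj B) 0, Sigma.desc fun _ => 𝟙 _, by simp, ?_⟩, ?_⟩
  · apply Sigma.hom_ext
    intro i
    obtain rfl := Subsingleton.elim i 0
    simp
  · apply Sigma.hom_ext
    intro i
    simp

theorem section_isDisjointSummandInclusion_and_disjointly_based
    {T : Type u} [SmallCategory T] (P : MorphismProperty T)
    (hwide : IsWideSubcategory P) (hatomic : IsAtomicOrbital P)
    {B : T} {Y : PSh T} (p : Y ⟶ yoneda.obj B) (hp : MemFinP P p)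
    (s : yoneda.obj B ⟶ Y) (hs : s ≫ p = 𝟙 (yoneda.obj B)) :
    IsDisjointSummandInclusion s ∧
    ∃ (X : PSh T) (q : X ⟶ yoneda.obj B), MemFinP P q ∧
      ∃ e : Y ≅ X ⨿ yoneda.obj B,
        e.hom ≫ coprod.desc q (𝟙 (yoneda.obj B)) = p ∧ s ≫ e.hom = coprod.inr := by
  suffices H : ∃ (X : PSh T) (q : X ⟶ yoneda.obj B), MemFinP P q ∧
      ∃ e : Y ≅ X ⨿ yoneda.obj B,
        e.hom ≫ coprod.desc q (𝟙 (yoneda.obj B)) = p ∧ s ≫ e.hom = coprod.inr by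
    refine ⟨?_, H⟩
    obtain ⟨X, q, -, e, -, he⟩ := H
    refine ⟨X, coprod.inl ≫ e.inv, ⟨?_⟩⟩
    refine IsColimit.ofIsoColimit (BinaryCofan.isColimitFlip (coprodIsCoprod X (yoneda.obj B)))
      (BinaryCofan.ext e.symm ?_ ?_)
    · change coprod.inr ≫ e.inv = s
      rw [← he]; simp
    · rfl
  obtain ⟨n, A, r, hr, e, rfl⟩ := aux_norm P hwide p hp
  obtain ⟨i0, a, ha⟩ := aux_sigma A (s ≫ e.hom)
  have har : a ≫ r i0 = 𝟙 B := by
    apply yoneda.map_injective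
    rw [← Category.assoc, ha] at hs
    simpa using hs
  have hra := aux_sec (r i0) a har (hatomic.2 _ (hr i0))
  obtain _ | n := n
  · exact i0.elim0
  let X : PSh T := ∐ fun k => yoneda.obj (A (i0.succAbove k))
  let inv : (X ⨿ yoneda.obj B) ⟶ ∐ fun i => yoneda.obj (A i) :=
    coprod.desc (Sigma.desc fun k => Sigma.ι (fun i => yoneda.obj (A i)) (i0.succAbove k))
      (yoneda.map a ≫ Sigma.ι (fun i => yoneda.obj (A i)) i0)
  have i1 : coprod.inl ≫ inv =
      Sigma.desc fun k => Sigma.ι (fun i => yoneda.obj (A i)) (i0.succAbove k) :=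
    coprod.inl_desc _ _
  have i2 : coprod.inr ≫ inv = yoneda.map a ≫ Sigma.ι (fun i => yoneda.obj (A i)) i0 :=
    coprod.inr_desc _ _
  let comp : ∀ i, yoneda.obj (A i) ⟶ X ⨿ yoneda.obj B :=
    Fin.succAboveCases i0 (yoneda.map (r i0) ≫ coprod.inr)
      (fun k => Sigma.ι (fun k => yoneda.obj (A (i0.succAbove k))) k ≫ coprod.inl)
  have c0 : comp i0 = yoneda.map (r i0) ≫ coprod.inr := by simp [comp]
  have ck : ∀ k, comp (i0.succAbove k) =
      Sigma.ι (fun k => yoneda.obj (A (i0.succAbove k))) k ≫ coprod.inl := by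
    intro k; simp [comp]
  let E : (∐ fun i => yoneda.obj (A i)) ≅ X ⨿ yoneda.obj B :=
    { hom := Sigma.desc comp
      inv := inv
      hom_inv_id := by
        apply Sigma.hom_ext
        intro i
        rw [Sigma.ι_desc_assoc, Category.comp_id]
        induction i using Fin.succAboveCases i0 with
        | x => 
          rw [c0, Category.assoc, i2, ← Category.assoc, ← Functor.map_comp, hra]
          simp
        | p k =>
          rw [ck, Category.assoc, i1, Sigma.ι_desc]
      inv_hom_id := by
        apply coprod.hom_ext
        · apply Sigma.hom_ext
          intro k
          rw [← Category.assoc coprod.inl, i1, Sigma.ι_desc_assoc, Sigma.ι_desc, ck,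
            Category.comp_id]
        · rw [← Category.assoc coprod.inr, i2, Category.assoc, Sigma.ι_desc, c0, Category.comp_id]
          rw [← Category.assoc, ← Functor.map_comp, har]; simp }
  refine ⟨X, Sigma.desc fun k => yoneda.map (r (i0.succAbove k)),
    aux_mem P _ _ (fun k => hr _), e ≪≫ E, ?_, ?_⟩
  · rw [Iso.trans_hom, Category.assoc]
    congr 1
    apply Sigma.hom_ext
    intro i
    change _ ≫ Sigma.desc comp ≫ _ = _
    rw [Sigma.ι_desc_assoc, Sigma.ι_desc]
    induction i using Fin.succAboveCases i0 with
    | x => rw [c0, Category.assoc, coprod.inr_desc, Category.comp_id]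
    | p k => rw [ck, Category.assoc, coprod.inl_desc, Sigma.ι_desc]
  · rw [Iso.trans_hom, ← Category.assoc, ha, Category.assoc]
    simp only [E, Sigma.ι_desc, c0]
    rw [← Category.assoc, ← Functor.map_comp, har]; simp
end

section
/- Let T be a category, P a wide subcategory of T, and B an object of T. Let P/B denote the wide subcategory of the slice category T/B consisting of those morphisms over B whose underlying morphism in T lies in P. If P is orbital, then P/B is an orbital wide subcategory of T/B; and if P is atomic orbital, then P/B is an atomic orbital wide subcategory of T/B. -/
open CategoryTheory CategoryTheory.Limits

universe u

variable (T : Type u) [SmallCategory T]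

variable {T}

/-- The wide subcategory `P/B` of the slice category `T/B` consisting of the morphisms over
`B` whose underlying morphism in `T` lies in `P`. -/
def sliceProperty (P : MorphismProperty T) (B : T) : MorphismProperty (Over B) :=
  fun _ _ f => P f.left

/-!
Statement 11: if `P` is an orbital wide subcategory of `T`, then `P/B` is an orbital wide
subcategory of `T/B`; if `P` is atomic orbital, then so is `P/B`.
-/

open Opposite

/-- A family of elements freely generating `X`. -/
def Gen (X : PSh T) {n : ℕ} (A : Fin n → T) (x : ∀ i, X.obj (op (A i))) : Prop :=
  ∀ U : T, Function.Bijective (fun s : (Σ i, (U ⟶ A i)) => X.map s.2.op (x s.1))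

lemma gen_iff (X : PSh T) {n : ℕ} (A : Fin n → T) (c : ∀ i, yoneda.obj (A i) ⟶ X) :
    Gen X A (fun i => yonedaEquiv (c i)) ↔ Nonempty (IsColimit (Cofan.mk X c)) := by
  have key : ∀ U : T, Function.Bijective
        (fun s : (Σ i, (U ⟶ A i)) => X.map s.2.op (yonedaEquiv (c s.1))) ↔
      Nonempty (IsColimit (Cofan.mk (X.obj (op U)) (fun i => (c i).app (op U)))) := by
    intro U
    rw [Cofan.nonempty_isColimit_iff_bijective_fromSigma]
    have : (fun s : (Σ i, (U ⟶ A i)) => X.map s.2.op (yonedaEquiv (c s.1))) =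
      (Cofan.mk (X.obj (op U)) (fun i => (c i).app (op U))).cofanTypes.fromSigma := by
      funext ⟨i, s⟩
      change X.map s.op (yonedaEquiv (c i)) = (c i).app (op U) s
      rw [yonedaEquiv_naturality, yonedaEquiv_apply]
      simp
    rw [this]
    rfl
  constructor
  · intro h
    refine ⟨evaluationJointlyReflectsColimits _ fun U => ?_⟩
    exact (isColimitMapCoconeCofanMkEquiv ((evaluation _ _).obj U) _ _).symm
      ((key U.unop).1 (h U.unop)).some
  · rintro ⟨h⟩ U
    rw [key]
    exact ⟨isColimitMapCoconeCofanMkEquiv ((evaluation _ _).obj (op U)) _ _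
      (isColimitOfPreserves _ h)⟩

lemma isFinite_iff (X : PSh T) : IsFiniteTSet X ↔
    ∃ (n : ℕ) (A : Fin n → T) (x : ∀ i, X.obj (op (A i))), Gen X A x := by
  constructor
  · rintro ⟨n, A, ⟨e⟩⟩
    refine ⟨n, A, fun i => yonedaEquiv (Sigma.ι (fun i => yoneda.obj (A i)) i ≫ e.inv), ?_⟩
    rw [gen_iff]
    exact ⟨IsColimit.ofIsoColimit (coproductIsCoproduct _) (Cofan.ext e.symm (by intro i; rfl))⟩
  · rintro ⟨n, A, x, h⟩
    refine ⟨n, A, ?_⟩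
    have h' := (gen_iff X A (fun i => yonedaEquiv.symm (x i))).1 (by simpa using h)
    exact ⟨h'.some.coconePointUniqueUpToIso (coproductIsCoproduct _)⟩

lemma memFinP_iff (P : MorphismProperty T) {X Y : PSh T} (f : X ⟶ Y) : MemFinP P f ↔
    ∃ (n m : ℕ) (A : Fin n → T) (B : Fin m → T) (σ : Fin n → Fin m)
    (p : ∀ i, A i ⟶ B (σ i)) (x : ∀ i, X.obj (op (A i))) (y : ∀ j, Y.obj (op (B j))),
      (∀ i, P (p i)) ∧ Gen X A x ∧ Gen Y B y ∧
      ∀ i, f.app _ (x i) = Y.map (p i).op (y (σ i)) := by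
  constructor
  · rintro ⟨n, m, A, B, σ, p, hp, eX, eY, h⟩
    refine ⟨n, m, A, B, σ, p,
      fun i => yonedaEquiv (Sigma.ι (fun i => yoneda.obj (A i)) i ≫ eX.inv),
      fun i => yonedaEquiv (Sigma.ι (fun i => yoneda.obj (B i)) i ≫ eY.inv), hp, ?_, ?_, ?_⟩
    · rw [gen_iff]
      exact ⟨IsColimit.ofIsoColimit (coproductIsCoproduct _) (Cofan.ext eX.symm (by intro i; rfl))⟩
    · rw [gen_iff]
      exact ⟨IsColimit.ofIsoColimit (coproductIsCoproduct _) (Cofan.ext eY.symm (by intro i; rfl))⟩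
    · intro i
      rw [← yonedaEquiv_comp, yonedaEquiv_naturality]
      congr 1
      rw [← cancel_mono eY.hom]
      simp [h]
  · rintro ⟨n, m, A, B, σ, p, x, y, hp, hx, hy, h⟩
    have hx' := ((gen_iff X A (fun i => yonedaEquiv.symm (x i))).1 (by simpa using hx)).some
    have hy' := ((gen_iff Y B (fun i => yonedaEquiv.symm (y i))).1 (by simpa using hy)).some
    refine ⟨n, m, A, B, σ, p, hp, hx'.coconePointUniqueUpToIso (coproductIsCoproduct _),
      hy'.coconePointUniqueUpToIso (coproductIsCoproduct _), ?_⟩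
    refine Cofan.IsColimit.hom_ext hx' _ _ fun i => ?_
    have e1 := hx'.comp_coconePointUniqueUpToIso_hom (coproductIsCoproduct _) ⟨i⟩
    have e2 := hy'.comp_coconePointUniqueUpToIso_hom (coproductIsCoproduct _) ⟨σ i⟩
    dsimp at e1 e2
    have e3 : yonedaEquiv.symm (x i) ≫ f = yoneda.map (p i) ≫ yonedaEquiv.symm (y (σ i)) := by
      rw [yonedaEquiv_symm_naturality_left, yonedaEquiv_symm_naturality_right, h]
    change yonedaEquiv.symm (x i) ≫ f ≫ _ = yonedaEquiv.symm (x i) ≫ _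
    rw [reassoc_of% e3, e2, reassoc_of% e1]
    simp

/-- The total space of a presheaf on `Over B`. -/
def tot {B : T} (X : PSh (Over B)) : PSh T where
  obj U := Σ b : U.unop ⟶ B, X.obj (op (Over.mk b))
  map {U V} r := ↾fun s => ⟨r.unop ≫ s.1,
    X.map (Over.homMk r.unop rfl : Over.mk (r.unop ≫ s.1) ⟶ Over.mk s.1).op s.2⟩
  map_id U := by
    refine ConcreteCategory.hom_ext _ _ ?_
    rintro ⟨b, x⟩
    have : ∀ (c : U.unop ⟶ B) (r : U.unop ⟶ U.unop) (h : r ≫ b = c) (hr : r = 𝟙 _),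
        (⟨c, X.map (Over.homMk r h : Over.mk c ⟶ Over.mk b).op x⟩ :
          Σ b : U.unop ⟶ B, X.obj (op (Over.mk b))) = ⟨b, x⟩ := by
      rintro c r h rfl
      obtain rfl : b = c := by simpa using h
      have e : (Over.homMk (𝟙 (unop U)) h : Over.mk b ⟶ Over.mk b) = 𝟙 _ := by ext; rfl
      rw [e]
      simp
    exact this _ _ rfl rfl
  map_comp {U V W} r s := by
    refine ConcreteCategory.hom_ext _ _ ?_
    rintro ⟨b, x⟩
    have : ∀ (c : W.unop ⟶ B) (t : W.unop ⟶ U.unop) (h : t ≫ b = c)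
        (hr : t = s.unop ≫ r.unop),
        (⟨c, X.map (Over.homMk t h : Over.mk c ⟶ Over.mk b).op x⟩ :
          Σ b : W.unop ⟶ B, X.obj (op (Over.mk b))) =
        ⟨s.unop ≫ r.unop ≫ b, X.map
          (Over.homMk s.unop rfl : Over.mk (s.unop ≫ r.unop ≫ b) ⟶ Over.mk (r.unop ≫ b)).op
          (X.map (Over.homMk r.unop rfl : Over.mk (r.unop ≫ b) ⟶ Over.mk b).op x)⟩ := by
      rintro c t h rfl
      obtain rfl : s.unop ≫ r.unop ≫ b = c := by simpa using h
      congr 1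
      rw [← Functor.map_comp_apply, ← op_comp]
      congr 3
    exact this _ _ rfl rfl

/-- Functoriality of the total space. -/
def totMap {B : T} {X Y : PSh (Over B)} (f : X ⟶ Y) : tot X ⟶ tot Y where
  app U := ↾fun s => ⟨s.1, f.app _ s.2⟩
  naturality {U V} r := by
    refine ConcreteCategory.hom_ext _ _ ?_
    rintro ⟨b, x⟩
    have h := NatTrans.naturality_apply f
      (Over.homMk r.unop rfl : Over.mk (r.unop ≫ b) ⟶ Over.mk b).op x
    exact congrArg (Sigma.mk (β := fun b => Y.obj (op (Over.mk b))) (r.unop ≫ b)) h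

/-- An element of the total space. -/
def elt {B : T} (X : PSh (Over B)) (W : Over B) (x : X.obj (op W)) : (tot X).obj (op W.left) :=
  ⟨W.hom, x⟩

lemma elt_map {B : T} (X : PSh (Over B)) (W : Over B) (x : X.obj (op W)) {U : T}
    (r : U ⟶ W.left) (b : U ⟶ B) (x' : X.obj (op (Over.mk b))) :
    (tot X).map r.op (elt X W x) = elt X (Over.mk b) x' ↔
      ∃ w : r ≫ W.hom = b, X.map (Over.homMk r w : Over.mk b ⟶ W).op x = x' := by
  constructor
  · intro h
    cases h
    exact ⟨rfl, rfl⟩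
  · rintro ⟨rfl, rfl⟩
    rfl

lemma elt_surj {B : T} (X : PSh (Over B)) (U : T) (z : (tot X).obj (op U)) :
    ∃ (b : U ⟶ B) (x : _), z = elt X (Over.mk b) x := ⟨z.1, z.2, rfl⟩

lemma elt_inj {B : T} {X : PSh (Over B)} {W : Over B} {x x' : X.obj (op W)}
    (h : elt X W x = elt X W x') : x = x' := by
  cases h; rfl

lemma gen_tot {B : T} (X : PSh (Over B)) {n : ℕ} (A : Fin n → Over B)
    (x : ∀ i, X.obj (op (A i))) :
    Gen (tot X) (fun i => (A i).left) (fun i => elt X (A i) (x i)) ↔ Gen X A x := by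
  constructor
  · intro h V
    constructor
    · rintro ⟨i, φ⟩ ⟨j, ψ⟩ e
      have := @(h V.left).1 ⟨i, φ.left⟩ ⟨j, ψ.left⟩ ?_
      · obtain ⟨rfl, h⟩ := Sigma.mk.inj this
        rw [heq_eq_eq] at h
        obtain rfl : φ = ψ := by ext; exact h
        rfl
      · have e1 := (elt_map X (A i) (x i) φ.left V.hom (X.map φ.op (x i))).2 ⟨Over.w φ, rfl⟩
        have e2 := (elt_map X (A j) (x j) ψ.left V.hom (X.map ψ.op (x j))).2 ⟨Over.w ψ, rfl⟩
        dsimp only at e ⊢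
        rw [e1, e2, e]
    · intro z
      obtain ⟨⟨i, φ⟩, e⟩ := (h V.left).2 (elt X V z)
      obtain ⟨w, e⟩ := (elt_map X (A i) (x i) φ V.hom z).1 e
      exact ⟨⟨i, Over.homMk φ w⟩, e⟩
  · intro h U
    constructor
    · rintro ⟨i, φ⟩ ⟨j, ψ⟩ e
      dsimp only at e
      obtain ⟨b, z, hz⟩ := elt_surj X U ((tot X).map ψ.op (elt X (A j) (x j)))
      rw [hz] at e
      obtain ⟨w1, e1⟩ := (elt_map ..).1 e
      obtain ⟨w2, e2⟩ := (elt_map ..).1 hz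
      have := @(h (Over.mk b)).1 ⟨i, Over.homMk φ w1⟩ ⟨j, Over.homMk ψ w2⟩ (e1.trans e2.symm)
      obtain ⟨rfl, h⟩ := Sigma.mk.inj this
      rw [heq_eq_eq] at h
      obtain rfl : φ = ψ := congrArg (fun t => t.left) h
      rfl
    · intro z
      obtain ⟨b, z, rfl⟩ := elt_surj X U z
      obtain ⟨⟨i, φ⟩, e⟩ := (h (Over.mk b)).2 z
      exact ⟨⟨i, φ.left⟩, (elt_map ..).2 ⟨Over.w φ, e⟩⟩

lemma totMap_elt {B : T} {X Y : PSh (Over B)} (f : X ⟶ Y) (W : Over B) (x : X.obj (op W)) :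
    (totMap f).app _ (elt X W x) = elt Y W (f.app _ x) := rfl

lemma tot_finite {B : T} {X : PSh (Over B)} (h : IsFiniteTSet X) : IsFiniteTSet (tot X) := by
  obtain ⟨n, A, x, h⟩ := (isFinite_iff X).1 h
  exact (isFinite_iff _).2 ⟨n, _, _, (gen_tot X A x).2 h⟩

lemma memFinP_tot (P : MorphismProperty T) {B : T} {X Y : PSh (Over B)} (f : X ⟶ Y) :
    MemFinP P (totMap f) ↔ MemFinP (sliceProperty P B) f := by
  rw [memFinP_iff, memFinP_iff]
  constructor
  · rintro ⟨n, m, A, A', σ, p, x, y, hp, hx, hy, h⟩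
    choose a x' hx' using fun i => elt_surj X _ (x i)
    choose b y' hy' using fun i => elt_surj Y _ (y i)
    obtain rfl := funext hx'
    obtain rfl := funext hy'
    have h' := fun i => (elt_map Y (Over.mk (b (σ i))) (y' (σ i)) (p i) (a i)
      (f.app _ (x' i))).1 (h i).symm
    exact ⟨n, m, fun i => Over.mk (a i), fun i => Over.mk (b i), σ,
      fun i => Over.homMk (p i) (h' i).1, x', y', hp,
      (gen_tot X (fun i => Over.mk (a i)) x').1 hx, (gen_tot Y (fun i => Over.mk (b i)) y').1 hy,
      fun i => (h' i).2.symm⟩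
  · rintro ⟨n, m, A, A', σ, p, x, y, hp, hx, hy, h⟩
    refine ⟨n, m, fun i => (A i).left, fun i => (A' i).left, σ, fun i => (p i).left, _, _,
      fun i => hp i, (gen_tot X A x).2 hx,
      (gen_tot Y A' y).2 hy, fun i => ?_⟩
    rw [totMap_elt]
    exact ((elt_map Y (A' (σ i)) (y (σ i)) (p i).left (A i).hom (f.app _ (x i))).2
      ⟨Over.w (p i), (h i).symm⟩).symm

lemma tot_isPullback {B : T} {W X Y Z : PSh (Over B)} {a : W ⟶ X} {b : W ⟶ Y} {f : X ⟶ Z}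
    {g : Y ⟶ Z} (h : IsPullback a b f g) :
    IsPullback (totMap a) (totMap b) (totMap f) (totMap g) := by
  refine IsPullback.of_forall_isPullback_app fun U => ?_
  rw [Types.isPullback_iff]
  refine ⟨?_, ?_, ?_⟩
  · ext ⟨c, x⟩
    have := (Types.isPullback_iff _ _ _ _).1 (h.app (op (Over.mk c)))
    exact Sigma.ext rfl (heq_of_eq (types_congr_hom this.1 x))
  · rintro ⟨c, x⟩ ⟨c', y⟩ ⟨h1, h2⟩
    obtain ⟨rfl, h1'⟩ := Sigma.mk.inj h1
    obtain ⟨_, h2'⟩ := Sigma.mk.inj h2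
    have := (Types.isPullback_iff _ _ _ _).1 (h.app (op (Over.mk c)))
    obtain rfl := this.2.1 x y ⟨eq_of_heq h1', eq_of_heq h2'⟩
    rfl
  · rintro ⟨c, x⟩ ⟨c', y⟩ h1
    obtain ⟨rfl, h1'⟩ := Sigma.mk.inj h1
    have := (Types.isPullback_iff _ _ _ _).1 (h.app (op (Over.mk c)))
    obtain ⟨w, rfl, rfl⟩ := this.2.2 x y (eq_of_heq h1')
    exact ⟨⟨c, w⟩, rfl, rfl⟩

lemma memFinP_of_isPullback (P : MorphismProperty T) {W X Y Z : PSh T} {a : W ⟶ X} {b : W ⟶ Y}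
    {f : X ⟶ Z} {g : Y ⟶ Z} (h : IsPullback a b f g) (hp : MemFinP P (pullback.snd f g)) :
    MemFinP P b := by
  obtain ⟨n, m, A, B, σ, p, hp, eX, eY, e⟩ := hp
  refine ⟨n, m, A, B, σ, p, hp, h.isoPullback ≪≫ eX, eY, ?_⟩
  have e' := h.isoPullback_hom_snd
  rw [Iso.trans_hom, Category.assoc, ← e, reassoc_of% e']

lemma slice_orbital (P : MorphismProperty T) (B : T) (h : IsOrbital P) :
    IsOrbital (sliceProperty P B) := by
  intro X Y Z f g hf hY
  rw [← memFinP_tot] at hf ⊢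
  exact memFinP_of_isPullback P (tot_isPullback (IsPullback.of_hasPullback f g))
    (h _ _ hf (tot_finite hY))

lemma isDisjointSummandInclusion_iff {X Y : PSh T} (f : X ⟶ Y) :
    IsDisjointSummandInclusion f ↔ (∀ U, Function.Injective (f.app U)) ∧
      ∀ (U V) (r : U ⟶ V) (y : Y.obj U), Y.map r y ∈ Set.range (f.app V) →
        y ∈ Set.range (f.app U) := by
  constructor
  · rintro ⟨Z, g, ⟨h⟩⟩
    have key := fun U => (Types.binaryCofan_isColimit_iff _).1
      ⟨isColimitMapCoconeBinaryCofanEquiv ((evaluation _ _).obj U) _ _ (isColimitOfPreserves _ h)⟩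
    refine ⟨fun U => (key U).1, fun U V r y hy => ?_⟩
    have h1 : y ∈ Set.range (f.app U) ∪ Set.range (g.app U) := by
      have := (key U).2.2.sup_eq_top
      exact (Set.ext_iff.1 this y).2 trivial
    rcases h1 with h1 | ⟨z, rfl⟩
    · exact h1
    · exact ((key V).2.2.disjoint.le_bot
        ⟨hy, ⟨Z.map r z, NatTrans.naturality_apply g r z⟩⟩).elim
  · rintro ⟨h1, h2⟩
    let S : Subfunctor Y :=
      { obj := fun U => (Set.range (f.app U))ᶜ
        map := fun {U V} r y hy h => hy (h2 U V r y h) }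
    refine ⟨S.toFunctor, S.ι, ⟨evaluationJointlyReflectsColimits _ fun U => ?_⟩⟩
    refine (isColimitMapCoconeBinaryCofanEquiv ((evaluation _ _).obj U) _ _).symm
      (Nonempty.some ((Types.binaryCofan_isColimit_iff _).2 ⟨h1 U, ?_, ?_⟩))
    · exact Subtype.val_injective
    · have : Set.range (S.ι.app U) = (Set.range (f.app U))ᶜ := Subtype.range_val
      change IsCompl (Set.range (f.app U)) (Set.range (S.ι.app U))
      rw [this]
      exact isCompl_compl

lemma diag_iff {A B : T} (p : A ⟶ B) :
    IsDisjointSummandInclusion (pullback.diagonal (yoneda.map p)) ↔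
      ∀ (U V : T) (r : V ⟶ U) (a b : U ⟶ A), a ≫ p = b ≫ p → r ≫ a = r ≫ b → a = b := by
  have hp := fun U => (Types.isPullback_iff _ _ _ _).1
    ((IsPullback.of_hasPullback (yoneda.map p) (yoneda.map p)).app U)
  have d1 : ∀ U (a : (yoneda.obj A).obj U), (pullback.fst (yoneda.map p) (yoneda.map p)).app U
      ((pullback.diagonal (yoneda.map p)).app U a) = a := fun U a => by
    rw [← NatTrans.comp_app_apply, pullback.diagonal_fst]; rfl
  have d2 : ∀ U (a : (yoneda.obj A).obj U), (pullback.snd (yoneda.map p) (yoneda.map p)).app U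
      ((pullback.diagonal (yoneda.map p)).app U a) = a := fun U a => by
    rw [← NatTrans.comp_app_apply, pullback.diagonal_snd]; rfl
  have dr : ∀ U z, z ∈ Set.range ((pullback.diagonal (yoneda.map p)).app U) ↔
      (pullback.fst (yoneda.map p) (yoneda.map p)).app U z =
      (pullback.snd (yoneda.map p) (yoneda.map p)).app U z := by
    intro U z
    constructor
    · rintro ⟨a, rfl⟩
      rw [d1, d2]
    · intro h
      exact ⟨_, (hp U).2.1 _ _ ⟨d1 _ _, (d2 _ _).trans h⟩⟩
  rw [isDisjointSummandInclusion_iff]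
  constructor
  · rintro ⟨-, h⟩ U V r a b h1 h2
    obtain ⟨z, rfl, rfl⟩ := (hp (op U)).2.2 a b h1
    refine (dr _ _).1 (h (op U) (op V) r.op z ((dr _ _).2 ?_))
    rw [NatTrans.naturality_apply, NatTrans.naturality_apply]
    exact h2
  · intro h
    refine ⟨fun U a b e => ?_, fun U V r z hz => ?_⟩
    · rw [← d1 U a, e, d1]
    · rw [dr] at hz ⊢
      rw [NatTrans.naturality_apply, NatTrans.naturality_apply] at hz
      exact h U.unop V.unop r.unop _ _ (types_congr_hom (hp U).1 z) hz

theorem sliceProperty_isOrbital_and_isAtomicOrbital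
    {T : Type u} [SmallCategory T] (P : MorphismProperty T)
    (hwide : IsWideSubcategory P) (B : T) :
    (IsOrbital P → IsOrbital (sliceProperty P B)) ∧
    (IsAtomicOrbital P → IsAtomicOrbital (sliceProperty P B)) := by
  refine ⟨slice_orbital P B, fun h => ⟨slice_orbital P B h.1, fun {A A'} p hp => ?_⟩⟩
  have := (diag_iff p.left).1 (h.2 p.left hp)
  rw [diag_iff]
  intro U V r a b h1 h2
  ext
  exact this U.left V.left r.left a.left b.left (congrArg (fun t => t.left) h1)
    (congrArg (fun t => t.left) h2)
end

section
/- Let T be a category and (P_i)_{i ∈ I} a nonempty family of orbital wide subcategories of T. Then the intersection ⋂_{i ∈ I} P_i is again an orbital wide subcategory of T. -/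
open CategoryTheory CategoryTheory.Limits

universe u

variable (T : Type u) [SmallCategory T]

variable {T}

/-- The intersection of a family of wide subcategories. -/
def interProperty {ι : Type*} (P : ι → MorphismProperty T) : MorphismProperty T :=
  fun _ _ f => ∀ i, P i f

/-!
Statement 12: the intersection of a nonempty family of orbital wide subcategories of `T` is
again an orbital wide subcategory of `T`.
-/

/-- Explicit model of a coproduct of representables. -/
def auxF {n : ℕ} (A : Fin n → T) : PSh T where
  obj U := Σ i, (U.unop ⟶ A i)
  map g := TypeCat.ofHom fun x => ⟨x.1, g.unop ≫ x.2⟩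

def auxι {n : ℕ} (A : Fin n → T) (i : Fin n) : yoneda.obj (A i) ⟶ auxF A where
  app U := TypeCat.ofHom fun a => ⟨i, a⟩

lemma aux_inj {n : ℕ} (A : Fin n → T) {U : T} {i j : Fin n} (a : U ⟶ A i) (b : U ⟶ A j)
    (h : yoneda.map a ≫ Sigma.ι (fun j => yoneda.obj (A j)) i =
      yoneda.map b ≫ Sigma.ι (fun j => yoneda.obj (A j)) j) :
    (⟨i, a⟩ : Σ i, (U ⟶ A i)) = ⟨j, b⟩ := by
  have h2 := congrArg (fun q => q ≫ Sigma.desc (auxι A)) h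
  simp only [Category.assoc, Sigma.ι_desc] at h2
  have h3 := ConcreteCategory.congr_hom (NatTrans.congr_app h2 (Opposite.op U)) (𝟙 U)
  have h4 : (⟨i, 𝟙 U ≫ a⟩ : Σ i, (U ⟶ A i)) = ⟨j, 𝟙 U ≫ b⟩ := h3
  simpa only [Category.id_comp] using h4

lemma aux_surj {n : ℕ} (A : Fin n → T) {U : T}
    (x : yoneda.obj U ⟶ ∐ fun j => yoneda.obj (A j)) :
    ∃ (i : Fin n) (a : U ⟶ A i),
      x = yoneda.map a ≫ Sigma.ι (fun j => yoneda.obj (A j)) i := by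
  obtain ⟨⟨i⟩, a, ha⟩ := Types.jointly_surjective_of_isColimit
    (isColimitOfPreserves ((evaluation Tᵒᵖ (Type u)).obj (Opposite.op U))
      (colimit.isColimit (Discrete.functor fun j => yoneda.obj (A j)))) (yonedaEquiv x)
  refine ⟨i, a, ?_⟩
  apply yonedaEquiv.injective
  rw [← ha, yonedaEquiv_comp, yonedaEquiv_yoneda_map]
  rfl

lemma aux_iso {n m : ℕ} (A : Fin n → T) (B : Fin m → T)
    (e : (∐ fun j => yoneda.obj (A j)) ≅ ∐ fun j => yoneda.obj (B j)) (k : Fin n) :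
    ∃ (l : Fin m) (a : A k ⟶ B l), IsIso a ∧
      Sigma.ι (fun j => yoneda.obj (A j)) k ≫ e.hom =
        yoneda.map a ≫ Sigma.ι (fun j => yoneda.obj (B j)) l := by
  obtain ⟨l, a, ha⟩ := aux_surj B (Sigma.ι (fun j => yoneda.obj (A j)) k ≫ e.hom)
  obtain ⟨k', b, hb⟩ := aux_surj A (Sigma.ι (fun j => yoneda.obj (B j)) l ≫ e.inv)
  have h1 := aux_inj A (𝟙 (A k)) (a ≫ b) (by
    rw [Functor.map_comp, Category.assoc, ← hb, ← reassoc_of% ha]; simp)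
  obtain rfl : k = k' := congrArg Sigma.fst h1
  have h1' : 𝟙 (A k) = a ≫ b := by simpa using h1
  have h2 := aux_inj B (𝟙 (B l)) (b ≫ a) (by
    rw [Functor.map_comp, Category.assoc, ← ha, ← reassoc_of% hb]; simp)
  have h2' : 𝟙 (B l) = b ≫ a := by simpa using h2
  exact ⟨l, a, ⟨b, h1'.symm, h2'.symm⟩, ha⟩

lemma aux_mem_s12 {P : MorphismProperty T} (hP : IsWideSubcategory P) {X Y : PSh T} {f : X ⟶ Y}
    (hf : MemFinP P f) {n m : ℕ} {A : Fin n → T} {B : Fin m → T} {σ : Fin n → Fin m}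
    (p : ∀ i, A i ⟶ B (σ i))
    (eX : X ≅ ∐ fun i => yoneda.obj (A i)) (eY : Y ≅ ∐ fun j => yoneda.obj (B j))
    (h : f ≫ eY.hom = eX.hom ≫ Sigma.desc fun i =>
          yoneda.map (p i) ≫ Sigma.ι (fun j => yoneda.obj (B j)) (σ i)) (k : Fin n) :
    P (p k) := by
  obtain ⟨n', m', A', B', σ', p', hp', eX', eY', h'⟩ := hf
  obtain ⟨k', a, ia, ha⟩ := aux_iso A A' (eX.symm ≪≫ eX') k
  obtain ⟨l, b, ib, hb⟩ := aux_iso B B' (eY.symm ≪≫ eY') (σ k)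
  have key : (Sigma.desc fun i =>
          yoneda.map (p i) ≫ Sigma.ι (fun j => yoneda.obj (B j)) (σ i)) ≫
        (eY.symm ≪≫ eY').hom = (eX.symm ≪≫ eX').hom ≫ Sigma.desc fun i =>
          yoneda.map (p' i) ≫ Sigma.ι (fun j => yoneda.obj (B' j)) (σ' i) := by
    simp only [Iso.trans_hom, Iso.symm_hom, Category.assoc]
    rw [← h', ← cancel_epi eX.hom, ← reassoc_of% h]
    simp
  have h3 := aux_inj B' (p k ≫ b) (a ≫ p' k') (by
    have := congrArg (fun q => Sigma.ι (fun j => yoneda.obj (A j)) k ≫ q) key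
    simp only [Sigma.ι_desc_assoc, Category.assoc] at this
    rw [hb, reassoc_of% ha, Sigma.ι_desc] at this
    simpa using this)
  obtain rfl : l = σ' k' := congrArg Sigma.fst h3
  have h4 : p k ≫ b = a ≫ p' k' := by simpa using h3
  have h5 : p k = (a ≫ p' k') ≫ inv b := by rw [← h4]; simp
  rw [h5]
  exact hP.2 _ _ (hP.2 _ _ (hP.1 a ia) (hp' k')) (hP.1 _ inferInstance)

theorem interProperty_isWide_and_isOrbital
    {T : Type u} [SmallCategory T] {ι : Type*} [Nonempty ι]
    (P : ι → MorphismProperty T)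
    (hwide : ∀ i, IsWideSubcategory (P i)) (horb : ∀ i, IsOrbital (P i)) :
    IsWideSubcategory (interProperty P) ∧ IsOrbital (interProperty P) := by
  refine ⟨⟨fun f hf i => (hwide i).1 f hf, fun f g hf hg i => (hwide i).2 f g (hf i) (hg i)⟩, ?_⟩
  intro X Y Z f g hf hY
  have hall : ∀ i, MemFinP (P i) (pullback.snd f g) := fun i => by
    obtain ⟨n, m, A, B, σ, p, hp, r⟩ := hf
    exact horb i f g ⟨n, m, A, B, σ, p, fun k => hp k i, r⟩ hY
  obtain ⟨i₀⟩ := ‹Nonempty ι›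
  obtain ⟨n, m, A, B, σ, p, hp, eX, eY, h⟩ := hall i₀
  exact ⟨n, m, A, B, σ, p, fun k i => aux_mem_s12 (hwide i) (hall i) p eX eY h k, eX, eY, h⟩
end
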